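/- arXiv:1810.10426 — 2 statements merged into one kernel-verified Lean document; each statement's English description precedes it below -/
import Mathlib

section
/- Let f : ℕ → ℂ be a non-identically-zero function that is periodic with period q ≥ 1, and consider F(s, f, 1) = ∑_{n=0}^∞ f(n)/(n+1)^s, a Dirichlet series with periodic coefficients. If there do not exist a Dirichlet polynomial P(s) = ∑_{n ∈ 𝒩} a(n) n^{-s} (𝒩 a finite nonempty set of positive integers) and a Dirichlet character χ such that F(s, f, 1) = P(s)·L(s, χ) for all s with Re(s) > 1, then F(s, f, 1) has infinitely many zeros s with Re(s) > 1. -/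
open Filter Topology Metric

/-- Minimum modulus principle: a function that is smaller at an inner point than on the
boundary circle has a zero in the disc. -/
theorem exists_zero_of_norm_lt_on_sphere {f : ℂ → ℂ} {c z : ℂ} {r m : ℝ} (hr : 0 < r)
    (hf : DiffContOnCl ℂ f (ball c r)) (hz : z ∈ closedBall c r)
    (hm : ∀ w ∈ sphere c r, m ≤ ‖f w‖) (hzm : ‖f z‖ < m) :
    ∃ w ∈ ball c r, f w = 0 := by
  by_contra! h
  have hm0 : 0 < m := (norm_nonneg _).trans_lt hzm
  have hne : ∀ w ∈ closure (ball c r), f w ≠ 0 := by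
    intro w hw
    rw [closure_ball c hr.ne', ← ball_union_sphere] at hw
    rcases hw with hw | hw
    · exact h w hw
    · exact fun h0 => by have := hm w hw; rw [h0, norm_zero] at this; linarith
  have hle := Complex.norm_le_of_forall_mem_frontier_norm_le isBounded_ball (hf.inv hne)
    (C := m⁻¹) (fun w hw => by
      rw [frontier_ball c hr.ne'] at hw
      simpa using inv_anti₀ hm0 (hm w hw)) (z := z) (by rwa [closure_ball c hr.ne'])
  have hz0 : 0 < ‖f z‖ := norm_pos_iff.2 (hne z (by rwa [closure_ball c hr.ne']))
  simp only [Pi.inv_apply, norm_inv] at hle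
  exact absurd ((inv_le_inv₀ hz0 hm0).1 hle) (not_le.2 hzm)

/-- A quantitative form of Hurwitz's theorem: functions close to `f` near an isolated zero of `f`
have a zero there too. -/
theorem exists_zero_of_close {f : ℂ → ℂ} {U : Set ℂ} (hU : IsOpen U) {c : ℂ} (hc : c ∈ U)
    (hf : DifferentiableOn ℂ f U) (h0 : f c = 0) (hne : ∃ᶠ z in 𝓝 c, f z ≠ 0) {ρ : ℝ}
    (hρ : 0 < ρ) :
    ∃ r, 0 < r ∧ r < ρ ∧ closedBall c r ⊆ U ∧ ∃ ε, 0 < ε ∧ ∀ g : ℂ → ℂ, DifferentiableOn ℂ g U →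
      (∀ z ∈ closedBall c r, ‖g z - f z‖ < ε) → ∃ w ∈ closedBall c r, g w = 0 := by
  have hev : ∀ᶠ z in 𝓝[≠] c, f z ≠ 0 :=
    ((hf.analyticAt (hU.mem_nhds hc)).eventually_eq_zero_or_eventually_ne_zero).resolve_left
      fun h => by
        obtain ⟨z, hz, hz'⟩ := (hne.and_eventually h).exists
        exact hz hz'
  rw [eventually_nhdsWithin_iff] at hev
  obtain ⟨ρ', hρ', hball⟩ := Metric.eventually_nhds_iff_ball.1 (hev.and (hU.mem_nhds hc))
  obtain ⟨r, hr, hrlt⟩ := exists_between (lt_min hρ hρ')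
  have hrρ' : r < ρ' := hrlt.trans_le (min_le_right _ _)
  have hsub : closedBall c r ⊆ ball c ρ' := closedBall_subset_ball hrρ'
  have hsubU : closedBall c r ⊆ U := fun z hz => (hball z (hsub hz)).2
  refine ⟨r, hr, hrlt.trans_le (min_le_left _ _), hsubU, ?_⟩
  have hcont : ContinuousOn (fun z => ‖f z‖) (sphere c r) :=
    (hf.continuousOn.mono (sphere_subset_closedBall.trans hsubU)).norm
  obtain ⟨w, hw, hmin⟩ := (isCompact_sphere c r).exists_isMinOn
    (NormedSpace.sphere_nonempty.2 hr.le) hcont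
  have hw0 : 0 < ‖f w‖ := norm_pos_iff.2
    ((hball w (hsub (sphere_subset_closedBall hw))).1 (ne_of_mem_sphere hw hr.ne'))
  refine ⟨‖f w‖ / 2, half_pos hw0, fun g hg hclose => ?_⟩
  have hgd : DiffContOnCl ℂ g (ball c r) :=
    (hg.mono (by rwa [closure_ball c hr.ne'])).diffContOnCl
  obtain ⟨w', hw', hgw'⟩ := exists_zero_of_norm_lt_on_sphere (m := ‖f w‖ / 2) hr hgd
    (mem_closedBall_self hr.le) (fun v hv => by
      have h1 : ‖f w‖ ≤ ‖f v‖ := hmin hv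
      have h2 := hclose v (sphere_subset_closedBall hv)
      have h3 : ‖f v‖ ≤ ‖g v‖ + ‖g v - f v‖ := by
        rw [norm_sub_rev]; simpa [add_comm] using norm_le_norm_add_norm_sub' (f v) (g v)
      linarith) (by simpa [h0] using hclose c (mem_closedBall_self hr.le))
  exact ⟨w', ball_subset_closedBall hw', hgw'⟩

/-- Continuity of zeros: if the zeros of a continuous family of holomorphic functions on the
closed unit disc disappear along the family, then one of them crosses the unit circle. -/
theorem exists_zero_on_sphere_of_family {g : ℝ → ℂ → ℂ}
    (hg : ContinuousOn (fun x : ℝ × ℂ => g x.1 x.2) (Set.Icc 0 1 ×ˢ closedBall 0 1))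
    (hd : ∀ r ∈ Set.Icc (0 : ℝ) 1, DiffContOnCl ℂ (g r) (ball 0 1))
    (h0 : ∃ t ∈ closedBall (0 : ℂ) 1, g 0 t = 0)
    (h1 : ∀ t ∈ closedBall (0 : ℂ) 1, g 1 t ≠ 0) :
    ∃ r ∈ Set.Icc (0 : ℝ) 1, ∃ t ∈ sphere (0 : ℂ) 1, g r t = 0 := by
  by_contra! h
  have hK : IsCompact (Set.Icc (0 : ℝ) 1 ×ˢ closedBall (0 : ℂ) 1) :=
    isCompact_Icc.prod (isCompact_closedBall _ _)
  have hS : IsCompact (Set.Icc (0 : ℝ) 1 ×ˢ sphere (0 : ℂ) 1) :=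
    isCompact_Icc.prod (isCompact_sphere _ _)
  obtain ⟨⟨r₀, t₀⟩, hx, hmin⟩ := hS.exists_isMinOn
    ⟨((0 : ℝ), (1 : ℂ)), by simp⟩
    (hg.mono (Set.prod_mono le_rfl sphere_subset_closedBall)).norm
  have hm : 0 < ‖g r₀ t₀‖ := norm_pos_iff.2 (h r₀ hx.1 t₀ hx.2)
  have hZ : IsCompact ((Set.Icc (0 : ℝ) 1 ×ˢ closedBall (0 : ℂ) 1) ∩
      (fun x : ℝ × ℂ => g x.1 x.2) ⁻¹' {0}) :=
    hK.of_isClosed_subset (hg.preimage_isClosed_of_isClosed hK.isClosed isClosed_singleton)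
      Set.inter_subset_left
  obtain ⟨t, ht, hgt⟩ := h0
  obtain ⟨⟨r, t⟩, ⟨⟨hr, ht⟩, hrt⟩, hmax⟩ := hZ.exists_isMaxOn ⟨((0 : ℝ), t), by
    simp only [Set.mem_inter_iff, Set.mem_prod, Set.mem_preimage, Set.mem_singleton_iff]
    exact ⟨⟨by simp, ht⟩, hgt⟩⟩ continuous_fst.continuousOn
  simp only [Set.mem_preimage, Set.mem_singleton_iff] at hr ht hrt
  have hr1 : r < 1 := lt_of_le_of_ne hr.2 fun h => h1 t ht (by rw [← h]; exact hrt)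
  have hcr : ContinuousWithinAt (fun r' => ‖g r' t‖) (Set.Icc 0 1) r := by
    have : ContinuousOn (fun r' => g r' t) (Set.Icc (0 : ℝ) 1) :=
      hg.comp (f := fun r' : ℝ => (r', t)) (by fun_prop) (fun r' hr' => ⟨hr', ht⟩)
    exact (this r hr).norm
  have hev : ∀ᶠ r' in 𝓝[Set.Icc 0 1] r, ‖g r' t‖ < ‖g r₀ t₀‖ := by
    refine hcr.eventually_lt_const (by simpa [hrt] using hm)
  have hev' : ∀ᶠ r' in 𝓝[>] r, r' ∈ Set.Icc (0 : ℝ) 1 ∧ ‖g r' t‖ < ‖g r₀ t₀‖ := by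
    have hle : 𝓝[Set.Ioc r 1] r ≤ 𝓝[Set.Icc 0 1] r :=
      nhdsWithin_mono _ fun x hx => ⟨hr.1.trans hx.1.le, hx.2⟩
    rw [nhdsWithin_Ioc_eq_nhdsGT hr1] at hle
    exact hle (eventually_mem_nhdsWithin.and hev)
  obtain ⟨r', ⟨hr', hlt⟩, hgt'⟩ := (hev'.and self_mem_nhdsWithin).exists
  obtain ⟨w, hw, hgw⟩ := exists_zero_of_norm_lt_on_sphere one_pos (hd r' hr') ht
    (fun v hv => hmin (show (r', v) ∈ _ from ⟨hr', hv⟩)) hlt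
  exact absurd (hmax (show (r', w) ∈ _ from ⟨⟨hr', ball_subset_closedBall hw⟩, hgw⟩))
    (not_le.2 hgt')

/-- A zero of a holomorphic function in the closed polydisc can be pushed to the torus, as soon as
in each variable there is a zero-free disc over some point of the torus. -/
theorem exists_zero_on_torus {ι : Type*} [Fintype ι] [DecidableEq ι] [Nonempty ι]
    {G : (ι → ℂ) → ℂ}
    (hG : ∀ z : ι → ℂ, (∀ i, ‖z i‖ ≤ 1) → DifferentiableAt ℂ G z)
    (hfree : ∀ i, ∃ ω : ι → ℂ, (∀ j, ‖ω j‖ = 1) ∧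
      ∀ t : ℂ, ‖t‖ ≤ 1 → G (Function.update ω i t) ≠ 0)
    (hzero : ∃ z : ι → ℂ, (∀ i, ‖z i‖ ≤ 1) ∧ G z = 0) :
    ∃ z : ι → ℂ, (∀ i, ‖z i‖ = 1) ∧ G z = 0 := by
  have hupd : ∀ (z : ι → ℂ) (i : ι) (t : ℂ), (∀ j, ‖z j‖ ≤ 1) → ‖t‖ ≤ 1 →
      ∀ j, ‖Function.update z i t j‖ ≤ 1 := by
    intro z i t hz ht j
    rcases eq_or_ne j i with rfl | hj
    · simpa using ht
    · simpa [hj] using hz j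
  have hfam : ∀ (i : ι) (γ : ℝ → ι → ℂ), Continuous γ →
      (∀ r ∈ Set.Icc (0 : ℝ) 1, ∀ j, ‖γ r j‖ ≤ 1) → G (γ 0) = 0 →
      (∀ t ∈ closedBall (0 : ℂ) 1, G (Function.update (γ 1) i t) ≠ 0) →
      ∃ r ∈ Set.Icc (0 : ℝ) 1, ∃ t ∈ sphere (0 : ℂ) 1, G (Function.update (γ r) i t) = 0 := by
    intro i γ hγ hγ1 hγ0 hfin
    have hdiff : ∀ (z : ι → ℂ) (t : ℂ), (∀ j, ‖z j‖ ≤ 1) → ‖t‖ ≤ 1 →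
        DifferentiableAt ℂ (fun t => G (Function.update z i t)) t := fun z t hz ht =>
      (hG _ (hupd z i t hz ht)).comp t (hasDerivAt_update z i t).differentiableAt
    refine exists_zero_on_sphere_of_family (g := fun r t => G (Function.update (γ r) i t)) ?_ ?_
      ⟨γ 0 i, by simpa using hγ1 0 (by simp) i, by simpa using hγ0⟩ hfin
    · intro x hx
      have h1 : ContinuousAt G (Function.update (γ x.1) i x.2) :=
        (hG _ (hupd _ i _ (hγ1 _ hx.1) (by simpa using hx.2))).continuousAt
      have h2 : ContinuousAt (fun x : ℝ × ℂ => Function.update (γ x.1) i x.2) x :=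
        (Continuous.update (hγ.comp continuous_fst) i continuous_snd).continuousAt
      exact (ContinuousAt.comp (f := fun x : ℝ × ℂ => Function.update (γ x.1) i x.2)
        h1 h2).continuousWithinAt
    · intro r hr
      refine DifferentiableOn.diffContOnCl fun t ht => ?_
      rw [closure_ball _ one_ne_zero] at ht
      exact (hdiff _ t (hγ1 r hr) (by simpa using ht)).differentiableWithinAt
  obtain ⟨z, hz, hGz⟩ := hzero
  induction hn : (Finset.univ.filter fun i => ‖z i‖ ≠ 1).card using Nat.strong_induction_on
    generalizing z with
  | _ n ih =>
  by_cases hall : ∀ i, ‖z i‖ = 1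
  · exact ⟨z, hall, hGz⟩
  push Not at hall
  obtain ⟨i, hi⟩ := hall
  have hdec : ∀ (z' : ι → ℂ) (k : ι), ‖z k‖ ≠ 1 → ‖z' k‖ = 1 →
      (∀ j, ‖z j‖ = 1 → ‖z' j‖ = 1) → (∀ j, ‖z' j‖ ≤ 1) → G z' = 0 →
      ∃ z : ι → ℂ, (∀ i, ‖z i‖ = 1) ∧ G z = 0 := by
    intro z' k hk hk' hj hz' hG'
    refine ih _ ?_ z' hz' hG' rfl
    rw [← hn]
    refine Finset.card_lt_card (Finset.ssubset_iff_of_subset ?_ |>.2 ⟨k, ?_, ?_⟩)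
    · intro j hj'
      simp only [Finset.mem_filter, Finset.mem_univ, true_and] at hj' ⊢
      exact fun h => hj' (hj j h)
    · simpa using hk
    · simpa using hk'
  by_cases hex : ∃ k, k ≠ i ∧ ‖z k‖ ≠ 1
  · obtain ⟨k, hki, hk⟩ := hex
    let γ : ℝ → ι → ℂ := fun r => Function.update z k ((1 - r) * z k + r)
    have hγc : Continuous γ := by
      refine continuous_const.update k (by fun_prop)
    have hγle : ∀ r ∈ Set.Icc (0 : ℝ) 1, ∀ j, ‖γ r j‖ ≤ 1 := by
      intro r hr
      refine hupd z k _ hz ?_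
      have h1 : ‖((1 : ℂ) - r)‖ = 1 - r := by
        rw [← Complex.ofReal_one, ← Complex.ofReal_sub, Complex.norm_of_nonneg (by linarith [hr.2])]
      calc ‖(1 - (r : ℂ)) * z k + r‖ ≤ ‖(1 - (r : ℂ)) * z k‖ + ‖(r : ℂ)‖ := norm_add_le _ _
        _ = (1 - r) * ‖z k‖ + r := by rw [norm_mul, h1, Complex.norm_of_nonneg hr.1]
        _ ≤ 1 := by nlinarith [hz k, hr.2]
    have hγ0 : γ 0 = z := by simp [γ]
    by_cases hfin : ∃ t ∈ closedBall (0 : ℂ) 1, G (Function.update (γ 1) i t) = 0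
    · obtain ⟨t, ht, hGt⟩ := hfin
      refine hdec (Function.update (γ 1) i t) k hk (by simp [hki, γ]) ?_
        (hupd _ i t (hγle 1 (by simp)) (by simpa using ht)) hGt
      intro j hj
      have hji : j ≠ i := fun h => hi (h ▸ hj)
      have hjk : j ≠ k := fun h => hk (h ▸ hj)
      simpa [hji, hjk, γ] using hj
    · push Not at hfin
      obtain ⟨r, hr, t, ht, hGt⟩ := hfam i γ hγc hγle (by rw [hγ0, hGz]) hfin
      have ht1 : ‖t‖ = 1 := by simpa using ht
      refine hdec (Function.update (γ r) i t) i hi (by simpa using ht1) ?_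
        (hupd _ i t (hγle r hr) ht1.le) hGt
      intro j hj
      have hji : j ≠ i := fun h => hi (h ▸ hj)
      have hjk : j ≠ k := fun h => hk (h ▸ hj)
      simpa [hji, hjk, γ] using hj
  · push Not at hex
    obtain ⟨ω, hω, hfin⟩ := hfree i
    let γ : ℝ → ι → ℂ := fun r => Function.update
      (fun j => Complex.exp (((1 - r) * (z j).arg + r * (ω j).arg : ℝ) * Complex.I)) i (z i)
    have hexp : ∀ w : ℂ, ‖w‖ = 1 → Complex.exp (w.arg * Complex.I) = w := fun w hw => by
      simpa [hw] using Complex.norm_mul_exp_arg_mul_I w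
    have hγle : ∀ r : ℝ, ∀ j, ‖γ r j‖ ≤ 1 := fun r =>
      hupd _ i _ (fun j => (Complex.norm_exp_ofReal_mul_I _).le) (hz i)
    have hγ0 : γ 0 = z := by
      funext j
      rcases eq_or_ne j i with rfl | hj
      · simp [γ]
      · simp [γ, hj, hexp _ (hex j hj)]
    obtain ⟨r, hr, t, ht, hGt⟩ := hfam i γ (Continuous.update (by fun_prop) i continuous_const)
      (fun r _ => hγle r) (by rw [hγ0, hGz]) (fun t ht => by
        have : Function.update (γ 1) i t = Function.update ω i t := by
          funext j
          rcases eq_or_ne j i with rfl | hj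
          · simp
          · simp [γ, hj, hexp _ (hω j)]
        rw [this]
        exact hfin t (by simpa using ht))
    refine ⟨_, fun j => ?_, hGt⟩
    rcases eq_or_ne j i with rfl | hj
    · simpa using ht
    · simp only [γ, Function.update_of_ne hj]
      exact Complex.norm_exp_ofReal_mul_I _

theorem one_add_sum_le_prod_one_add_of_nonneg {ι : Type*} (s : Finset ι) (u : ι → ℝ)
    (hu : ∀ i ∈ s, 0 ≤ u i) : 1 + ∑ i ∈ s, u i ≤ ∏ i ∈ s, (1 + u i) := by
  classical
  induction s using Finset.induction_on with
  | empty => simp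
  | insert a s ha ih =>
    rw [Finset.sum_insert ha, Finset.prod_insert ha]
    have h1 := ih fun i hi => hu i (Finset.mem_insert_of_mem hi)
    have h2 := hu a (Finset.mem_insert_self _ _)
    have h3 : 0 ≤ ∑ i ∈ s, u i := Finset.sum_nonneg fun i hi => hu i (Finset.mem_insert_of_mem hi)
    nlinarith

/-- A product of factors `1 - ξ x` with `|ξ| = 1` exceeds the corresponding product of factors
`1 - x` when many `ξ` stay away from `1`. -/
theorem mul_prod_one_sub_sq_le_prod_norm_sq (Q : Finset ℕ) (x : ℕ → ℝ) (ξ : ℕ → ℂ)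
    (hx : ∀ p ∈ Q, 0 ≤ x p ∧ x p ≤ 1 / 2) (hξ : ∀ p ∈ Q, ‖ξ p‖ = 1) :
    (1 + ∑ p ∈ Q, 2 * (1 - (ξ p).re) * x p) * (∏ p ∈ Q, (1 - x p)) ^ 2 ≤
      (∏ p ∈ Q, ‖1 - ξ p * x p‖) ^ 2 := by
  have hre : ∀ p ∈ Q, (ξ p).re ≤ 1 := fun p hp => (Complex.re_le_norm _).trans (hξ p hp).le
  have h0 : ∀ p ∈ Q, 0 ≤ 2 * (1 - (ξ p).re) * x p := fun p hp =>
    mul_nonneg (by linarith [hre p hp]) (hx p hp).1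
  calc _ ≤ (∏ p ∈ Q, (1 + 2 * (1 - (ξ p).re) * x p)) * (∏ p ∈ Q, (1 - x p)) ^ 2 :=
        mul_le_mul_of_nonneg_right (one_add_sum_le_prod_one_add_of_nonneg _ _ h0) (sq_nonneg _)
    _ = ∏ p ∈ Q, ((1 + 2 * (1 - (ξ p).re) * x p) * (1 - x p) ^ 2) := by
        rw [Finset.prod_mul_distrib, Finset.prod_pow]
    _ ≤ ∏ p ∈ Q, ‖1 - ξ p * x p‖ ^ 2 := by
        refine Finset.prod_le_prod (fun p hp => ?_) fun p hp => ?_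
        · have := h0 p hp
          positivity
        · have h1 : (ξ p).re ^ 2 + (ξ p).im ^ 2 = 1 := by
            have := Complex.sq_norm (ξ p)
            rw [hξ p hp, Complex.normSq_apply] at this
            nlinarith
          have h2 : ‖1 - ξ p * x p‖ ^ 2 = (1 - x p) ^ 2 + 2 * (1 - (ξ p).re) * x p := by
            rw [Complex.sq_norm, Complex.normSq_apply]
            simp only [Complex.sub_re, Complex.one_re, Complex.mul_re, Complex.ofReal_re,
              Complex.ofReal_im, mul_zero, sub_zero, Complex.sub_im, Complex.one_im,
              Complex.mul_im, zero_add, zero_sub]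
            linear_combination x p ^ 2 * h1
          rw [h2]
          have h3 := h0 p hp
          have h4 : (1 - x p) ^ 2 ≤ 1 := by nlinarith [hx p hp]
          nlinarith
    _ = _ := Finset.prod_pow _ _ _

/-- The Euler factors `(1 - y)⁻¹` multiply to the exponential of `∑ y`, up to an error controlled
by `∑ |y| ^ 2`. -/
theorem exists_prod_inv_eq_exp (P : Finset ℕ) (y : ℕ → ℂ) {ε : ℝ} (hε : ε ≤ 1)
    (hP : ∀ p ∈ P, 2 ≤ p) (hy : ∀ p ∈ P, ‖y p‖ ≤ ε / p) :
    ∃ e : ℂ, ‖e‖ ≤ ε ^ 2 * ∑' n : ℕ, 1 / (n : ℝ) ^ 2 ∧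
      ∏ p ∈ P, (1 - y p)⁻¹ = Complex.exp (∑ p ∈ P, y p + e) := by
  have hhalf : ∀ p ∈ P, ‖y p‖ ≤ 1 / 2 := fun p hp => by
    have h2 : (2 : ℝ) ≤ p := by exact_mod_cast hP p hp
    refine (hy p hp).trans ?_
    rw [div_le_div_iff₀ (by linarith) two_pos]
    linarith
  refine ⟨∑ p ∈ P, (Complex.log (1 - y p)⁻¹ - y p), ?_, ?_⟩
  · have hterm : ∀ p ∈ P, ‖Complex.log (1 - y p)⁻¹ - y p‖ ≤ ε ^ 2 * (1 / (p : ℝ) ^ 2) := by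
      intro p hp
      have h1 := hhalf p hp
      have h2 : (1 - ‖y p‖)⁻¹ ≤ 2 := by
        rw [inv_le_comm₀ (by linarith) two_pos]
        linarith
      calc _ ≤ ‖y p‖ ^ 2 * (1 - ‖y p‖)⁻¹ / 2 :=
            Complex.norm_log_one_sub_inv_sub_self_le (by linarith)
        _ ≤ ‖y p‖ ^ 2 := by nlinarith [sq_nonneg ‖y p‖]
        _ ≤ (ε / p) ^ 2 := pow_le_pow_left₀ (norm_nonneg _) (hy p hp) 2
        _ = _ := by rw [div_pow]; ring
    calc _ ≤ ∑ p ∈ P, ε ^ 2 * (1 / (p : ℝ) ^ 2) := norm_sum_le_of_le _ hterm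
      _ = ε ^ 2 * ∑ p ∈ P, 1 / (p : ℝ) ^ 2 := (Finset.mul_sum _ _ _).symm
      _ ≤ _ := mul_le_mul_of_nonneg_left
        ((Real.summable_one_div_nat_pow.2 one_lt_two).sum_le_tsum _ fun _ _ => by positivity)
        (sq_nonneg _)
  · rw [Finset.sum_sub_distrib, add_sub_cancel, Complex.exp_sum]
    refine Finset.prod_congr rfl fun p hp => (Complex.exp_log (inv_ne_zero ?_)).symm
    intro h
    have := hhalf p hp
    rw [← sub_eq_zero.1 h, norm_one] at this
    norm_num at this

section CharacterSums

variable {q : ℕ} [NeZero q]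

/-- Prescribing all the sums `∑ χ(p) Z(p) x(p)` by coefficients `Z(p)` depending only on the residue
class of `p`. -/
theorem exists_class_coefficients (P : Finset ℕ) (x : ℕ → ℝ)
    (hPS : ∀ a : ZMod q, IsUnit a → 0 < ∑ p ∈ P with ((p : ℕ) : ZMod q) = a, x p)
    (V : DirichletCharacter ℂ q → ℂ) (χ : DirichletCharacter ℂ q) :
    ∑ p ∈ P, χ p * ((q.totient : ℂ)⁻¹ * (∑ ψ : DirichletCharacter ℂ q, ψ⁻¹ p * V ψ) /
      (∑ r ∈ P with ((r : ℕ) : ZMod q) = (p : ℕ), x r : ℝ)) * x p = V χ := by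
  classical
  have hφ : (q.totient : ℂ) ≠ 0 := by
    exact_mod_cast (Nat.totient_pos.2 (NeZero.pos q)).ne'
  have horth : ∀ ψ : DirichletCharacter ℂ q, ∑ a : ZMod q, χ a * ψ⁻¹ a =
      if χ = ψ then (q.totient : ℂ) else 0 := by
    intro ψ
    simp_rw [← MulChar.mul_apply]
    split_ifs with h
    · rw [h, mul_inv_cancel, MulChar.sum_one_eq_card_units, ZMod.card_units_eq_totient]
    · exact MulChar.sum_eq_zero_of_ne_one fun h' => h (mul_inv_eq_one.1 h')
  rw [← Finset.sum_fiberwise_of_maps_to (s := P) (t := Finset.univ)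
    (g := fun p : ℕ => (p : ZMod q)) (fun _ _ => Finset.mem_univ _)]
  calc _ = ∑ a : ZMod q, χ a * ((q.totient : ℂ)⁻¹ * ∑ ψ : DirichletCharacter ℂ q, ψ⁻¹ a * V ψ) := by
        refine Finset.sum_congr rfl fun a _ => ?_
        by_cases ha : IsUnit a
        · have hS : ((∑ r ∈ P with ((r : ℕ) : ZMod q) = a, x r : ℝ) : ℂ) ≠ 0 :=
            Complex.ofReal_ne_zero.2 (hPS a ha).ne'
          have h1 : ∀ p ∈ P.filter (fun p : ℕ => (p : ZMod q) = a),
              χ p * ((q.totient : ℂ)⁻¹ * (∑ ψ : DirichletCharacter ℂ q, ψ⁻¹ p * V ψ) /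
              (∑ r ∈ P with ((r : ℕ) : ZMod q) = (p : ℕ), x r : ℝ)) * x p =
              (χ a * ((q.totient : ℂ)⁻¹ * ∑ ψ : DirichletCharacter ℂ q, ψ⁻¹ a * V ψ) /
                (∑ r ∈ P with ((r : ℕ) : ZMod q) = a, x r : ℝ)) * x p := by
            intro p hp
            rw [(Finset.mem_filter.1 hp).2]
            ring
          rw [Finset.sum_congr rfl h1, ← Finset.mul_sum, ← Complex.ofReal_sum,
            div_mul_cancel₀ _ hS]
        · rw [MulChar.map_nonunit χ ha, zero_mul]
          refine Finset.sum_eq_zero fun p hp => ?_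
          rw [(Finset.mem_filter.1 hp).2, MulChar.map_nonunit χ ha, zero_mul, zero_mul]
    _ = (q.totient : ℂ)⁻¹ * ∑ ψ : DirichletCharacter ℂ q, (∑ a : ZMod q, χ a * ψ⁻¹ a) * V ψ := by
        simp_rw [Finset.sum_mul, Finset.mul_sum]
        rw [Finset.sum_comm]
        exact Finset.sum_congr rfl fun _ _ => Finset.sum_congr rfl fun _ _ => by ring
    _ = V χ := by
        simp_rw [horth, ite_mul, zero_mul]
        rw [Finset.sum_ite_eq Finset.univ χ, if_pos (Finset.mem_univ _),
          inv_mul_cancel_left₀ hφ]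

end CharacterSums

section PolydiscZero

variable {q : ℕ} [NeZero q] {P : ℕ → Finset ℕ} {x : ℕ → ℕ → ℝ}
  {C : ℕ → DirichletCharacter ℂ q → ℂ} {c : DirichletCharacter ℂ q → ℂ}
  {χ₁ χ₂ : DirichletCharacter ℂ q}

theorem exists_weighted_exp_sum_ne_zero (hne : χ₁ ≠ χ₂) (hc₂ : c χ₂ ≠ 0) :
    ∃ u : DirichletCharacter ℂ q → ℂ,
      ∑ χ ∈ Finset.univ.erase χ₁, c χ * Complex.exp (u χ) ≠ 0 := by
  classical
  by_contra! h
  have h0 := h 0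
  have h1 := h (Pi.single χ₂ (Complex.log 2))
  have hmem : χ₂ ∈ Finset.univ.erase χ₁ := Finset.mem_erase.2 ⟨hne.symm, Finset.mem_univ _⟩
  rw [← Finset.add_sum_erase _ _ hmem] at h0 h1
  have h2 : ∀ χ ∈ (Finset.univ.erase χ₁).erase χ₂,
      c χ * Complex.exp ((Pi.single χ₂ (Complex.log 2) : DirichletCharacter ℂ q → ℂ) χ) =
        c χ * Complex.exp ((0 : DirichletCharacter ℂ q → ℂ) χ) := fun χ hχ => by
    rw [Pi.single_eq_of_ne (Finset.ne_of_mem_erase hχ), Pi.zero_apply]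
  rw [Finset.sum_congr rfl h2, Pi.single_eq_same, Complex.exp_log two_ne_zero] at h1
  rw [Pi.zero_apply, Complex.exp_zero] at h0
  exact hc₂ (by linear_combination h1 - h0)

/-- Combinations of truncated Euler products over many primes have zeros in the closed polydisc. -/
theorem eventually_exists_zero_in_polydisc (hne : χ₁ ≠ χ₂)
    (hC : ∀ χ, Tendsto (fun k => C k χ) atTop (𝓝 (c χ))) (hc₁ : c χ₁ ≠ 0) (hc₂ : c χ₂ ≠ 0)
    (hP : ∀ k, ∀ p ∈ P k, 2 ≤ p)
    (hx : ∀ k, ∀ p ∈ P k, 0 ≤ x k p ∧ x k p ≤ 1 / p)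
    (hS : ∀ a : ZMod q, IsUnit a →
      Tendsto (fun k => ∑ p ∈ P k with ((p : ℕ) : ZMod q) = a, x k p) atTop atTop) :
    ∀ᶠ k in atTop, ∃ Z : ℕ → ℂ, (∀ p ∈ P k, ‖Z p‖ ≤ 1) ∧
      ∑ χ, C k χ * ∏ p ∈ P k, (1 - χ p * Z p * x k p)⁻¹ = 0 := by
  classical
  obtain ⟨u, hu⟩ := exists_weighted_exp_sum_ne_zero hne hc₂
  set D := ∑ χ ∈ Finset.univ.erase χ₁, c χ * Complex.exp (u χ) with hD
  let V : ℂ → DirichletCharacter ℂ q → ℂ := fun v χ => if χ = χ₁ then v else u χ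
  let h : ℂ → ℂ := fun v => ∑ χ, c χ * Complex.exp (V v χ)
  have hh : h = fun v => c χ₁ * Complex.exp v + D := by
    funext v
    simp only [h]
    rw [← Finset.add_sum_erase _ _ (Finset.mem_univ χ₁), hD]
    congr 1
    · simp [V]
    · exact Finset.sum_congr rfl fun χ hχ => by simp [V, Finset.ne_of_mem_erase hχ]
  set v₀ := Complex.log (-D / c χ₁)
  have hexp : Complex.exp v₀ = -D / c χ₁ := Complex.exp_log (div_ne_zero (neg_ne_zero.2 hu) hc₁)
  have hd : ∀ v, HasDerivAt h (c χ₁ * Complex.exp v) v := fun v => by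
    rw [hh]
    exact ((Complex.hasDerivAt_exp v).const_mul _).add_const _
  have hh0 : h v₀ = 0 := by
    rw [hh]
    simp only [hexp]
    field_simp
    ring
  obtain ⟨r, hr, hr1, hsub, δ, hδ, hclose⟩ := exists_zero_of_close (isOpen_ball (x := v₀) (ε := 1))
    (mem_ball_self one_pos) (fun v _ => (hd v).differentiableAt.differentiableWithinAt) hh0
    (((hd v₀).eventually_ne (c := 0)
      (mul_ne_zero hc₁ (Complex.exp_ne_zero _))).frequently.filter_mono
      nhdsWithin_le_nhds) one_pos
  let W : ℝ := 1 + (‖v₀‖ + 1) + ∑ χ, ‖u χ‖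
  have hsumu : ∀ χ, ‖u χ‖ ≤ ∑ χ, ‖u χ‖ := fun χ =>
    Finset.single_le_sum (f := fun χ => ‖u χ‖) (fun _ _ => norm_nonneg _) (Finset.mem_univ χ)
  have hVW : ∀ v ∈ ball v₀ 1, (∑ χ, ‖V v χ‖ ≤ W ∧ ∀ χ, ‖V v χ‖ ≤ W) := by
    intro v hv
    have hv' : ‖v‖ ≤ ‖v₀‖ + 1 := by
      rw [mem_ball_iff_norm] at hv
      have := norm_le_norm_add_norm_sub' v v₀
      linarith
    have h1 : ∑ χ, ‖V v χ‖ ≤ W := by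
      rw [← Finset.add_sum_erase _ _ (Finset.mem_univ χ₁)]
      have h2 : ∑ χ ∈ Finset.univ.erase χ₁, ‖V v χ‖ ≤ ∑ χ, ‖u χ‖ := by
        calc _ = ∑ χ ∈ Finset.univ.erase χ₁, ‖u χ‖ :=
              Finset.sum_congr rfl fun χ hχ => by simp [V, Finset.ne_of_mem_erase hχ]
          _ ≤ _ := Finset.sum_le_sum_of_subset_of_nonneg (Finset.erase_subset _ _)
            fun _ _ _ => norm_nonneg _
      have h3 : V v χ₁ = v := by simp [V]
      rw [h3]
      simp only [W]
      linarith
    exact ⟨h1, fun χ => (Finset.single_le_sum (f := fun χ => ‖V v χ‖)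
      (fun _ _ => norm_nonneg _) (Finset.mem_univ χ)).trans h1⟩
  have hW : 0 < W := by
    have : 0 ≤ ∑ χ, ‖u χ‖ := Finset.sum_nonneg fun _ _ => norm_nonneg _
    have := norm_nonneg v₀
    simp only [W]
    linarith
  set B : ℝ := ∑' n : ℕ, 1 / (n : ℝ) ^ 2
  have hB : 0 ≤ B := tsum_nonneg fun _ => by positivity
  have hsmall : Tendsto (fun ε : ℝ => Real.exp W * (2 * (ε ^ 2 * B) * ∑ χ, ‖c χ‖)) (𝓝[>] 0)
      (𝓝 0) := by
    have : Continuous fun ε : ℝ => Real.exp W * (2 * (ε ^ 2 * B) * ∑ χ, ‖c χ‖) := by fun_prop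
    simpa using (this.tendsto 0).mono_left nhdsWithin_le_nhds
  have hsmall' : Tendsto (fun ε : ℝ => ε ^ 2 * B) (𝓝[>] 0) (𝓝 0) := by
    have : Continuous fun ε : ℝ => ε ^ 2 * B := by fun_prop
    simpa using (this.tendsto 0).mono_left nhdsWithin_le_nhds
  obtain ⟨ε, hε0, hε1, hεδ, hεB⟩ := ((eventually_mem_nhdsWithin.and
    ((eventually_nhdsWithin_of_eventually_nhds (eventually_le_nhds one_pos)).and
    ((hsmall.eventually_lt_const (half_pos hδ)).and
      (hsmall'.eventually_lt_const (half_pos one_pos))))).exists :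
      ∃ ε : ℝ, _ ∧ _ ∧ _ ∧ _)
  have hε0 : 0 < ε := hε0
  have hCsum : Tendsto (fun k => Real.exp W * (2 * ∑ χ, ‖C k χ - c χ‖)) atTop (𝓝 0) := by
    have h1 : Tendsto (fun k => ∑ χ, ‖C k χ - c χ‖) atTop (𝓝 0) := by
      simpa using tendsto_finsetSum Finset.univ fun χ _ =>
        (tendsto_iff_norm_sub_tendsto_zero.1 (hC χ))
    simpa using (h1.const_mul 2).const_mul (Real.exp W)
  have hSev : ∀ᶠ k in atTop, ∀ a : ZMod q, IsUnit a →
      W / ε ≤ ∑ p ∈ P k with ((p : ℕ) : ZMod q) = a, x k p := by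
    refine eventually_all.2 fun a => ?_
    by_cases ha : IsUnit a
    · filter_upwards [(hS a ha).eventually_ge_atTop (W / ε)] with k hk _ using hk
    · exact Eventually.of_forall fun k h => absurd h ha
  filter_upwards [hSev, hCsum.eventually_lt_const (half_pos hδ)] with k hk hCk
  let S : ZMod q → ℝ := fun a => ∑ r ∈ P k with ((r : ℕ) : ZMod q) = a, x k r
  have hSpos : ∀ a, IsUnit a → 0 < S a := fun a ha => (div_pos hW hε0).trans_le (hk a ha)
  let Z : ℂ → ℕ → ℂ := fun v p => (q.totient : ℂ)⁻¹ *
    (∑ ψ : DirichletCharacter ℂ q, ψ⁻¹ p * V v ψ) / (S (p : ℕ) : ℝ)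
  have hZ : ∀ v ∈ ball v₀ 1, ∀ p, ‖Z v p‖ ≤ ε := by
    intro v hv p
    have hsum : ‖∑ ψ : DirichletCharacter ℂ q, ψ⁻¹ p * V v ψ‖ ≤ W := by
      refine (norm_sum_le _ _).trans ((Finset.sum_le_sum fun ψ _ => ?_).trans (hVW v hv).1)
      rw [norm_mul]
      exact mul_le_of_le_one_left (norm_nonneg _) (DirichletCharacter.norm_le_one _ _)
    by_cases hp : IsUnit ((p : ℕ) : ZMod q)
    · have hφ : ‖(q.totient : ℂ)⁻¹‖ ≤ 1 := by
        rw [norm_inv, Complex.norm_natCast]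
        exact inv_le_one_of_one_le₀ (by exact_mod_cast Nat.totient_pos.2 (NeZero.pos q))
      simp only [Z]
      rw [norm_div, norm_mul, Complex.norm_of_nonneg (hSpos _ hp).le, div_le_iff₀ (hSpos _ hp)]
      have h1 := (div_le_iff₀ hε0).1 (hk _ hp)
      calc _ ≤ 1 * W := mul_le_mul hφ hsum (norm_nonneg _) zero_le_one
        _ ≤ _ := by rw [one_mul, mul_comm]; exact h1
    · have : Z v p = 0 := by
        simp only [Z]
        rw [Finset.sum_eq_zero fun ψ _ => by rw [MulChar.map_nonunit _ hp, zero_mul]]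
        simp
      rw [this, norm_zero]
      exact hε0.le
  have hy : ∀ v ∈ ball v₀ 1, ∀ χ : DirichletCharacter ℂ q, ∀ p ∈ P k,
      ‖χ p * Z v p * x k p‖ ≤ ε / p := by
    intro v hv χ p hp
    rw [norm_mul, norm_mul, Complex.norm_of_nonneg (hx k p hp).1, div_eq_mul_one_div]
    refine mul_le_mul ?_ (hx k p hp).2 (hx k p hp).1 hε0.le
    exact (mul_le_of_le_one_left (norm_nonneg _) (DirichletCharacter.norm_le_one _ _)).trans
      (hZ v hv p)
  let g : ℂ → ℂ := fun v => ∑ χ, C k χ * ∏ p ∈ P k, (1 - χ p * Z v p * x k p)⁻¹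
  have hgd : DifferentiableOn ℂ g (ball v₀ 1) := by
    refine DifferentiableOn.fun_sum fun χ _ => DifferentiableOn.const_mul
      (DifferentiableOn.fun_finsetProd fun p hp => DifferentiableOn.fun_inv ?_ ?_) _
    · have hV : ∀ ψ, Differentiable ℂ fun v => V v ψ := by
        intro ψ
        by_cases hψ : ψ = χ₁
        · simp [V, hψ]
        · simp [V, hψ]
      have : Differentiable ℂ fun v => Z v p := by
        simp only [Z]
        fun_prop
      fun_prop
    · intro v hv h0
      have h1 := hy v hv χ p hp
      rw [← sub_eq_zero.1 h0, norm_one] at h1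
      have h2 : (2 : ℝ) ≤ p := by exact_mod_cast hP k p hp
      rw [le_div_iff₀ (by linarith)] at h1
      linarith
  obtain ⟨v, hv, hgv⟩ := hclose g hgd fun v hv => by
    have hv := hsub hv
    have hterm : ∀ χ, ‖C k χ * ∏ p ∈ P k, (1 - χ p * Z v p * x k p)⁻¹ -
        c χ * Complex.exp (V v χ)‖ ≤
        Real.exp W * (2 * ‖C k χ - c χ‖) + Real.exp W * (2 * (ε ^ 2 * B) * ‖c χ‖) := by
      intro χ
      obtain ⟨e, he, hprod⟩ := exists_prod_inv_eq_exp (P k) (fun p => χ p * Z v p * x k p)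
        hε1 (hP k) (hy v hv χ)
      rw [hprod, exists_class_coefficients (P k) (x k) hSpos (V v) χ, Complex.exp_add]
      have h1 : ‖Complex.exp e - 1‖ ≤ 2 * (ε ^ 2 * B) :=
        (Complex.norm_exp_sub_one_le (by linarith)).trans (by linarith)
      have h2 : ‖Complex.exp e‖ ≤ 2 := by
        have := norm_le_norm_add_norm_sub' (Complex.exp e) 1
        rw [norm_one] at this
        linarith
      have h3 : ‖Complex.exp (V v χ)‖ ≤ Real.exp W := by
        rw [Complex.norm_exp]
        exact Real.exp_le_exp.2 ((Complex.re_le_norm _).trans ((hVW v hv).2 χ))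
      have h4 : C k χ * (Complex.exp (V v χ) * Complex.exp e) - c χ * Complex.exp (V v χ) =
          Complex.exp (V v χ) * (Complex.exp e * (C k χ - c χ) + (Complex.exp e - 1) * c χ) := by
        ring
      rw [h4, norm_mul, ← mul_add]
      refine mul_le_mul h3 ((norm_add_le _ _).trans ?_) (norm_nonneg _) (Real.exp_pos _).le
      rw [norm_mul, norm_mul]
      gcongr
    calc ‖g v - h v‖ = ‖∑ χ, (C k χ * ∏ p ∈ P k, (1 - χ p * Z v p * x k p)⁻¹ -
        c χ * Complex.exp (V v χ))‖ := by rw [Finset.sum_sub_distrib]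
      _ ≤ ∑ χ, (Real.exp W * (2 * ‖C k χ - c χ‖) + Real.exp W * (2 * (ε ^ 2 * B) * ‖c χ‖)) :=
        norm_sum_le_of_le _ fun χ _ => hterm χ
      _ = Real.exp W * (2 * ∑ χ, ‖C k χ - c χ‖) +
          Real.exp W * (2 * (ε ^ 2 * B) * ∑ χ, ‖c χ‖) := by
        rw [Finset.sum_add_distrib]
        simp_rw [← Finset.mul_sum]
      _ < δ := by linarith
  exact ⟨Z v, fun p _ => (hZ v (hsub hv) p).trans hε1, hgv⟩

end PolydiscZero

theorem norm_dirichletCharacter_eq_one {q : ℕ} (χ : DirichletCharacter ℂ q) {a : ZMod q}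
    (ha : IsUnit a) : ‖χ a‖ = 1 := by
  obtain ⟨u, rfl⟩ := ha
  exact χ.unit_norm_eq_one u

section TorusZero

variable {q : ℕ} [NeZero q] {P : ℕ → Finset ℕ} {x : ℕ → ℕ → ℝ}
  {C : ℕ → DirichletCharacter ℂ q → ℂ} {c : DirichletCharacter ℂ q → ℂ}
  {χ₁ χ₂ : DirichletCharacter ℂ q}

/-- Rotating the primes by `conj (χ₁ p)` makes the `χ₁`-term dominate, whatever happens at a single
prime. -/
theorem eventually_sum_ne_zero_of_conj
    (hC : ∀ χ, Tendsto (fun k => C k χ) atTop (𝓝 (c χ))) (hc₁ : c χ₁ ≠ 0)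
    (hP : ∀ k, ∀ p ∈ P k, 2 ≤ p ∧ IsUnit ((p : ℕ) : ZMod q))
    (hx : ∀ k, ∀ p ∈ P k, 0 ≤ x k p ∧ x k p ≤ 1 / p)
    (hS : ∀ a : ZMod q, IsUnit a →
      Tendsto (fun k => ∑ p ∈ P k with ((p : ℕ) : ZMod q) = a, x k p) atTop atTop) :
    ∀ᶠ k in atTop, ∀ p₀ ∈ P k, ∀ t : ℂ, ‖t‖ ≤ 1 →
      ∑ χ, C k χ * ((1 - χ p₀ * t * x k p₀)⁻¹ *
        ∏ p ∈ (P k).erase p₀, (1 - χ p * star (χ₁ p) * x k p)⁻¹) ≠ 0 := by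
  classical
  have hxh : ∀ k, ∀ p ∈ P k, 0 ≤ x k p ∧ x k p ≤ 1 / 2 := fun k p hp => by
    have h2 : (2 : ℝ) ≤ p := by exact_mod_cast (hP k p hp).1
    exact ⟨(hx k p hp).1, (hx k p hp).2.trans (one_div_le_one_div_of_le two_pos h2)⟩
  have hex : ∀ χ : DirichletCharacter ℂ q, ∃ a : ZMod q, χ ≠ χ₁ →
      IsUnit a ∧ 0 < 2 * (1 - (χ a * star (χ₁ a)).re) := by
    intro χ
    by_cases hχ : χ = χ₁
    · exact ⟨0, fun h => absurd hχ h⟩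
    obtain ⟨a, ha⟩ : ∃ a : (ZMod q)ˣ, χ a ≠ χ₁ a := by
      by_contra! h
      exact hχ (MulChar.ext h)
    refine ⟨a, fun _ => ⟨a.isUnit, ?_⟩⟩
    have h1 : ‖χ a * star (χ₁ a)‖ = 1 := by
      rw [norm_mul, norm_star, norm_dirichletCharacter_eq_one _ a.isUnit,
        norm_dirichletCharacter_eq_one _ a.isUnit, one_mul]
    have h2 : χ₁ a * star (χ₁ a) = 1 := by
      rw [Complex.star_def, Complex.mul_conj', norm_dirichletCharacter_eq_one _ a.isUnit]
      norm_num
    have h3 : (χ a * star (χ₁ a)).re ≠ 1 := by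
      intro h
      have h4 : χ a * star (χ₁ a) = 1 := by
        have := Complex.sq_norm (χ a * star (χ₁ a))
        rw [h1, Complex.normSq_apply, h] at this
        refine Complex.ext h (by rw [Complex.one_im]; nlinarith)
      have h5 : star (χ₁ a) ≠ 0 := fun h => by rw [h, mul_zero] at h2; exact zero_ne_one h2
      exact ha (mul_right_cancel₀ h5 (h4.trans h2.symm))
    have h4 := (Complex.re_le_norm (χ a * star (χ₁ a))).trans h1.le
    have := lt_of_le_of_ne h4 h3
    linarith
  choose a ha using hex
  let κ : DirichletCharacter ℂ q → ℝ := fun χ => 2 * (1 - (χ (a χ) * star (χ₁ (a χ))).re)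
  let R : ℕ → DirichletCharacter ℂ q → ℝ := fun k χ =>
    1 + κ χ * (∑ p ∈ P k with ((p : ℕ) : ZMod q) = a χ, x k p - 1)
  have hR : ∀ χ, χ ≠ χ₁ → Tendsto (fun k => R k χ) atTop atTop := fun χ hχ =>
    tendsto_atTop_add_const_left _ _ (Tendsto.const_mul_atTop (ha χ hχ).2
      (tendsto_atTop_add_const_right _ _ (hS _ (ha χ hχ).1)))
  have hlim : Tendsto (fun k => ∑ χ ∈ Finset.univ.erase χ₁, 2 * ‖C k χ‖ * (Real.sqrt (R k χ))⁻¹)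
      atTop (𝓝 0) := by
    suffices h : Tendsto (fun k => ∑ χ ∈ Finset.univ.erase χ₁, 2 * ‖C k χ‖ * (Real.sqrt (R k χ))⁻¹)
        atTop (𝓝 (∑ χ ∈ Finset.univ.erase χ₁, 0)) by simpa using h
    refine tendsto_finsetSum _ fun χ hχ => ?_
    have h1 := ((hC χ).norm.const_mul 2).mul (tendsto_inv_atTop_zero.comp
      (Real.tendsto_sqrt_atTop.comp (hR χ (Finset.ne_of_mem_erase hχ))))
    simpa using h1
  have hRpos : ∀ᶠ k in atTop, ∀ χ, χ ≠ χ₁ → 0 < R k χ := by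
    refine eventually_all.2 fun χ => ?_
    by_cases hχ : χ = χ₁
    · exact Eventually.of_forall fun k h => absurd hχ h
    · filter_upwards [(hR χ hχ).eventually_gt_atTop 0] with k hk _ using hk
  have hc₁' : 0 < ‖c χ₁‖ := norm_pos_iff.2 hc₁
  have hmain := hlim.eventually_lt ((hC χ₁).norm.const_mul (1 / 2)) (by linarith)
  filter_upwards [hRpos, hmain] with k hRk hk p₀ hp₀ t ht h0
  set Q := (P k).erase p₀ with hQ
  have hQP : Q ⊆ P k := Finset.erase_subset _ _
  have hunit : ∀ (χ : DirichletCharacter ℂ q), ∀ p ∈ P k, ‖χ p‖ = 1 := fun χ p hp =>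
    norm_dirichletCharacter_eq_one χ (hP k p hp).2
  have hself : ∀ p ∈ P k, χ₁ p * star (χ₁ p) = 1 := fun p hp => by
    rw [Complex.star_def, Complex.mul_conj', hunit _ p hp]
    norm_num
  set M : ℝ := ∏ p ∈ Q, (1 - x k p) with hM
  have hMpos : 0 < M := Finset.prod_pos fun p hp => by linarith [(hxh k p (hQP hp)).2]
  have hyn : ∀ χ : DirichletCharacter ℂ q, ‖χ p₀ * t * x k p₀‖ ≤ 1 / 2 := fun χ => by
    rw [norm_mul, norm_mul, hunit χ p₀ hp₀, one_mul, Complex.norm_of_nonneg (hxh k p₀ hp₀).1]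
    nlinarith [hxh k p₀ hp₀, norm_nonneg t]
  have hfac : ∀ χ : DirichletCharacter ℂ q,
      ‖(1 - χ p₀ * t * x k p₀)⁻¹‖ ≤ 2 ∧ 1 / 2 ≤ ‖(1 - χ p₀ * t * x k p₀)⁻¹‖ := fun χ => by
    have h1 := norm_sub_norm_le (1 : ℂ) (χ p₀ * t * x k p₀)
    have h2 := norm_sub_le (1 : ℂ) (χ p₀ * t * x k p₀)
    rw [norm_one] at h1 h2
    have h3 := hyn χ
    rw [norm_inv]
    constructor
    · rw [inv_le_comm₀ (by linarith) two_pos]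
      linarith
    · rw [one_div, inv_le_inv₀ two_pos (by linarith)]
      linarith
  have hother : ∀ χ ∈ Finset.univ.erase χ₁,
      ‖C k χ * ((1 - χ p₀ * t * x k p₀)⁻¹ *
        ∏ p ∈ Q, (1 - χ p * star (χ₁ p) * x k p)⁻¹)‖ ≤
        2 * ‖C k χ‖ * (Real.sqrt (R k χ))⁻¹ * M⁻¹ := by
    intro χ hχ
    have hχ := Finset.ne_of_mem_erase hχ
    have hξ : ∀ p ∈ P k, ‖χ p * star (χ₁ p)‖ = 1 := fun p hp => by
      rw [norm_mul, norm_star, hunit _ p hp, hunit _ p hp, one_mul]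
    have h1 := mul_prod_one_sub_sq_le_prod_norm_sq Q (x k) (fun p => χ p * star (χ₁ p))
      (fun p hp => hxh k p (hQP hp)) (fun p hp => hξ p (hQP hp))
    have hnn : ∀ p ∈ P k, 0 ≤ 2 * (1 - (χ p * star (χ₁ p)).re) * x k p := fun p hp =>
      mul_nonneg (by linarith [(Complex.re_le_norm _).trans (hξ p hp).le]) (hxh k p hp).1
    have h2 : R k χ ≤ 1 + ∑ p ∈ Q, 2 * (1 - (χ p * star (χ₁ p)).re) * x k p := by
      have h3 : κ χ * (∑ p ∈ P k with ((p : ℕ) : ZMod q) = a χ, x k p - 1) ≤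
          κ χ * ∑ p ∈ Q with ((p : ℕ) : ZMod q) = a χ, x k p := by
        refine mul_le_mul_of_nonneg_left ?_ (ha χ hχ).2.le
        have h4 : ∑ p ∈ P k with ((p : ℕ) : ZMod q) = a χ, x k p ≤
            ∑ p ∈ insert p₀ (Q.filter fun p : ℕ => (p : ZMod q) = a χ), x k p := by
          refine Finset.sum_le_sum_of_subset_of_nonneg (fun p hp => ?_) fun p hp _ => ?_
          · rw [Finset.mem_filter] at hp
            rw [Finset.mem_insert, Finset.mem_filter, hQ, Finset.mem_erase]
            tauto
          · rcases Finset.mem_insert.1 hp with rfl | hp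
            · exact (hxh k _ hp₀).1
            · exact (hxh k _ (hQP (Finset.mem_filter.1 hp).1)).1
        rw [Finset.sum_insert (by simp [hQ])] at h4
        linarith [(hxh k p₀ hp₀).2]
      have h5 : κ χ * ∑ p ∈ Q with ((p : ℕ) : ZMod q) = a χ, x k p ≤
          ∑ p ∈ Q, 2 * (1 - (χ p * star (χ₁ p)).re) * x k p := by
        rw [Finset.mul_sum]
        calc _ = ∑ p ∈ Q with ((p : ℕ) : ZMod q) = a χ,
              2 * (1 - (χ p * star (χ₁ p)).re) * x k p :=
              Finset.sum_congr rfl fun p hp => by rw [(Finset.mem_filter.1 hp).2]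
          _ ≤ _ := Finset.sum_le_sum_of_subset_of_nonneg (Finset.filter_subset _ _)
            fun p hp _ => hnn p (hQP hp)
      simp only [R]
      linarith
    have h3 : Real.sqrt (R k χ) * M ≤ ∏ p ∈ Q, ‖1 - χ p * star (χ₁ p) * x k p‖ := by
      refine (pow_le_pow_iff_left₀ (mul_nonneg (Real.sqrt_nonneg _) hMpos.le)
        (Finset.prod_nonneg fun _ _ => norm_nonneg _) two_ne_zero).1 ?_
      rw [mul_pow, Real.sq_sqrt (hRk χ hχ).le]
      exact (mul_le_mul_of_nonneg_right h2 (sq_nonneg _)).trans h1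
    have h4 : 0 < Real.sqrt (R k χ) * M := mul_pos (Real.sqrt_pos.2 (hRk χ hχ)) hMpos
    rw [norm_mul, norm_mul, Finset.prod_inv_distrib, norm_inv (∏ p ∈ Q, _), norm_prod]
    calc _ ≤ ‖C k χ‖ * (2 * (Real.sqrt (R k χ) * M)⁻¹) := by
          refine mul_le_mul_of_nonneg_left ?_ (norm_nonneg _)
          exact mul_le_mul (hfac χ).1 (inv_anti₀ h4 h3) (by positivity) two_pos.le
      _ = _ := by rw [mul_inv]; ring
  have hfirst : 1 / 2 * ‖C k χ₁‖ * M⁻¹ ≤ ‖C k χ₁ * ((1 - χ₁ p₀ * t * x k p₀)⁻¹ *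
        ∏ p ∈ Q, (1 - χ₁ p * star (χ₁ p) * x k p)⁻¹)‖ := by
    have h1 : ∏ p ∈ Q, (1 - χ₁ p * star (χ₁ p) * x k p)⁻¹ = ((M⁻¹ : ℝ) : ℂ) := by
      rw [hM, Finset.prod_inv_distrib, Complex.ofReal_inv, Complex.ofReal_prod]
      congr 1
      refine Finset.prod_congr rfl fun p hp => ?_
      rw [hself p (hQP hp)]
      push_cast
      ring
    have h2 : 0 < M⁻¹ := inv_pos.2 hMpos
    rw [h1, norm_mul, norm_mul, Complex.norm_of_nonneg h2.le]
    have h3 := mul_le_mul_of_nonneg_left (hfac χ₁).2 (mul_nonneg (norm_nonneg (C k χ₁)) h2.le)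
    linarith
  rw [← Finset.add_sum_erase _ _ (Finset.mem_univ χ₁)] at h0
  have h1 := hfirst
  rw [eq_neg_of_add_eq_zero_left h0, norm_neg] at h1
  have h2 := h1.trans (norm_sum_le_of_le _ hother)
  rw [← Finset.sum_mul] at h2
  exact absurd (le_of_mul_le_mul_right h2 (inv_pos.2 hMpos)) (not_le.2 hk)

/-- Combinations of truncated Euler products over many primes vanish for a suitable rotation of
the primes. -/
theorem eventually_exists_unimodular_zero (hne : χ₁ ≠ χ₂)
    (hC : ∀ χ, Tendsto (fun k => C k χ) atTop (𝓝 (c χ))) (hc₁ : c χ₁ ≠ 0) (hc₂ : c χ₂ ≠ 0)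
    (hP : ∀ k, ∀ p ∈ P k, 2 ≤ p ∧ IsUnit ((p : ℕ) : ZMod q))
    (hx : ∀ k, ∀ p ∈ P k, 0 ≤ x k p ∧ x k p ≤ 1 / p)
    (hS : ∀ a : ZMod q, IsUnit a →
      Tendsto (fun k => ∑ p ∈ P k with ((p : ℕ) : ZMod q) = a, x k p) atTop atTop) :
    ∀ᶠ k in atTop, ∃ ω : ℕ → ℂ, (∀ p, ‖ω p‖ = 1) ∧
      ∑ χ, C k χ * ∏ p ∈ P k, (1 - χ p * ω p * x k p)⁻¹ = 0 := by
  classical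
  have hne0 : ∀ᶠ k in atTop, (P k).Nonempty := by
    filter_upwards [(hS 1 isUnit_one).eventually_gt_atTop 0] with k hk
    by_contra h
    rw [Finset.not_nonempty_iff_eq_empty.1 h] at hk
    simp at hk
  filter_upwards [eventually_exists_zero_in_polydisc hne hC hc₁ hc₂ (fun k p hp => (hP k p hp).1)
    hx hS, eventually_sum_ne_zero_of_conj hC hc₁ hP hx hS, hne0] with k hk hfree hPk
  obtain ⟨Z, hZ, hZ0⟩ := hk
  have : Nonempty (P k) := hPk.to_subtype
  let G : (P k → ℂ) → ℂ := fun z => ∑ χ, C k χ * ∏ i : P k, (1 - χ (i : ℕ) * z i * x k i)⁻¹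
  suffices h : ∃ z : P k → ℂ, (∀ i, ‖z i‖ = 1) ∧ G z = 0 by
    obtain ⟨z, hz, hz0⟩ := h
    refine ⟨fun p => if h : p ∈ P k then z ⟨p, h⟩ else 1, fun p => ?_, ?_⟩
    · by_cases h : p ∈ P k
      · simpa [h] using hz ⟨p, h⟩
      · simp [h]
    · rw [← hz0]
      refine Finset.sum_congr rfl fun χ _ => ?_
      rw [← Finset.prod_coe_sort (P k)]
      congr 1
      exact Finset.prod_congr rfl fun i _ => by simp only [i.2, dite_true]
  refine exists_zero_on_torus (G := G) ?_ ?_ ?_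
  · intro z hz
    have hd : ∀ (χ : DirichletCharacter ℂ q) (i : P k), DifferentiableAt ℂ
        (fun z : P k → ℂ => (1 - χ (i : ℕ) * z i * x k i)⁻¹) z := fun χ i => by
      refine DifferentiableAt.fun_inv (by fun_prop) fun h0 => ?_
      have h2 : (2 : ℝ) ≤ (i : ℕ) := by exact_mod_cast (hP k i i.2).1
      have h1 : ‖χ (i : ℕ) * z i * x k i‖ ≤ 1 / 2 := by
        rw [norm_mul, norm_mul, Complex.norm_of_nonneg (hx k i i.2).1]
        have h3 := (hx k i i.2).2.trans (one_div_le_one_div_of_le two_pos h2)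
        have h4 := mul_le_one₀ (DirichletCharacter.norm_le_one χ (i : ℕ)) (norm_nonneg _) (hz i)
        nlinarith [(hx k i i.2).1, h4]
      rw [← sub_eq_zero.1 h0, norm_one] at h1
      norm_num at h1
    exact DifferentiableAt.fun_sum fun χ _ => DifferentiableAt.const_mul
      (HasFDerivAt.finsetProd fun i _ => (hd χ i).hasFDerivAt).differentiableAt _
  · intro i
    refine ⟨fun j => star (χ₁ (j : ℕ)), fun j => ?_, fun t ht => ?_⟩
    · rw [norm_star, norm_dirichletCharacter_eq_one _ (hP k j j.2).2]
    · convert hfree i i.2 t ht using 1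
      refine Finset.sum_congr rfl fun χ _ => ?_
      congr 1
      rw [← Finset.mul_prod_erase Finset.univ _ (Finset.mem_univ i), Function.update_self]
      congr 1
      have : ((P k).erase (i : ℕ)) = (Finset.univ.erase i).map (Function.Embedding.subtype _) := by
        ext p
        simp only [Finset.mem_erase, Finset.mem_map, Finset.mem_univ, and_true,
          Function.Embedding.subtype_apply]
        constructor
        · rintro ⟨h1, h2⟩
          exact ⟨⟨p, h2⟩, fun h => h1 (by rw [← h]), rfl⟩
        · rintro ⟨j, hj, rfl⟩
          exact ⟨fun h => hj (Subtype.ext h), j.2⟩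
      rw [this, Finset.prod_map]
      refine Finset.prod_congr rfl fun j hj => ?_
      rw [Function.update_of_ne (Finset.ne_of_mem_erase hj)]
      rfl
  · refine ⟨fun i => Z i, fun i => hZ i i.2, ?_⟩
    rw [← hZ0]
    refine Finset.sum_congr rfl fun χ _ => ?_
    rw [← Finset.prod_coe_sort (P k)]

end TorusZero

section PrimeSums

open ArithmeticFunction.vonMangoldt

theorem summable_rpow_neg_of_one_lt {x : ℝ} (hx : 1 < x) (S : Set ℕ) :
    Summable (S.indicator fun p : ℕ => (p : ℝ) ^ (-x)) :=
  (Real.summable_nat_rpow.2 (by linarith)).indicator _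

theorem summable_residueClass_div_rpow {q : ℕ} (a : ZMod q) {x : ℝ} (hx : 1 < x) :
    Summable fun n : ℕ => residueClass a n / (n : ℝ) ^ x := by
  have h := LSeriesSummable_of_abscissaOfAbsConv_lt_re (s := (x : ℂ))
    ((abscissaOfAbsConv_residueClass_le_one a).trans_lt (by
      rw [Complex.ofReal_re]; exact_mod_cast hx))
  refine (summable_norm_iff.2 h).congr fun n => ?_
  rcases eq_or_ne n 0 with rfl | hn
  · simp
  rw [LSeries.term_of_ne_zero hn, norm_div, Complex.norm_of_nonneg (residueClass_nonneg a n),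
    Complex.norm_natCast_cpow_of_pos (Nat.pos_of_ne_zero hn), Complex.ofReal_re]

variable {q : ℕ} [NeZero q] {a : ZMod q}

/-- The sum over the primes in a residue class of `log p / p ^ x` has a simple pole at `1`. -/
theorem exists_tsum_prime_log_lower_bound (ha : IsUnit a) :
    ∃ c > 0, ∃ C, 0 ≤ C ∧ ∀ x ∈ Set.Ioc (1 : ℝ) 2, c / (x - 1) - C ≤
      ∑' n : ℕ, {p : ℕ | p.Prime ∧ (p : ZMod q) = a}.indicator
        (fun p : ℕ => Real.log p * (p : ℝ) ^ (-x)) n ∧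
      Summable ({p : ℕ | p.Prime ∧ (p : ZMod q) = a}.indicator
        (fun p : ℕ => Real.log p * (p : ℝ) ^ (-x))) := by
  obtain ⟨C, hC⟩ := LSeries_residueClass_lower_bound ha
  set g : ℕ → ℝ := fun n => (if n.Prime then 0 else residueClass a n) / n with hg
  have hgs : Summable g := summable_residueClass_non_primes_div a
  refine ⟨(q.totient : ℝ)⁻¹, inv_pos.2 (by exact_mod_cast Nat.totient_pos.2 (NeZero.pos q)),
    |C| + |∑' n, g n|, by positivity, fun x hx => ?_⟩
  have hsum := summable_residueClass_div_rpow a hx.1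
  have hind : ∀ n : ℕ, {p : ℕ | p.Prime ∧ (p : ZMod q) = a}.indicator
      (fun p : ℕ => Real.log p * (p : ℝ) ^ (-x)) n =
      (if n.Prime then residueClass a n else 0) / (n : ℝ) ^ x := by
    intro n
    by_cases hn : n.Prime
    · by_cases hna : (n : ZMod q) = a
      · rw [Set.indicator_of_mem (show n ∈ {p : ℕ | p.Prime ∧ (p : ZMod q) = a} from ⟨hn, hna⟩),
          if_pos hn, residueClass,
          Set.indicator_of_mem (show n ∈ {n : ℕ | (n : ZMod q) = a} from hna),
          ArithmeticFunction.vonMangoldt_apply_prime hn, Real.rpow_neg (Nat.cast_nonneg n),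
          div_eq_mul_inv]
      · rw [Set.indicator_of_notMem (fun h => hna h.2), if_pos hn, residueClass,
          Set.indicator_of_notMem (show n ∉ {n : ℕ | (n : ZMod q) = a} from hna), zero_div]
    · rw [Set.indicator_of_notMem (fun h => hn h.1), if_neg hn, zero_div]
  have hnn : ∀ n, 0 ≤ residueClass a n := residueClass_nonneg a
  have hps : Summable fun n : ℕ => (if n.Prime then residueClass a n else 0) / (n : ℝ) ^ x := by
    refine Summable.of_nonneg_of_le (fun n => ?_) (fun n => ?_) hsum
    · split_ifs
      · exact div_nonneg (hnn n) (by positivity)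
      · simp
    · split_ifs
      · exact le_rfl
      · rw [zero_div]; exact div_nonneg (hnn n) (by positivity)
  have hle : ∀ n : ℕ, residueClass a n / (n : ℝ) ^ x ≤
      (if n.Prime then residueClass a n else 0) / (n : ℝ) ^ x + g n := by
    intro n
    rcases eq_or_ne n 0 with rfl | hn
    · simp [hg]
    by_cases hp : n.Prime
    · simp [hg, hp]
    · simp only [hg, hp, if_false, zero_div, zero_add]
      have h1 : (1 : ℝ) ≤ n := by exact_mod_cast Nat.pos_of_ne_zero hn
      refine div_le_div_of_nonneg_left (hnn n) (by linarith) ?_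
      simpa using Real.rpow_le_rpow_of_exponent_le h1 hx.1.le
  have h1 := hsum.tsum_le_tsum hle (hps.add hgs)
  rw [hps.tsum_add hgs] at h1
  refine ⟨?_, hps.congr fun n => (hind n).symm⟩
  rw [tsum_congr hind]
  linarith [hC hx, le_abs_self C, le_abs_self (∑' n, g n)]

/-- A quantitative form of Dirichlet's theorem. -/
theorem tendsto_tsum_prime_rpow_atTop (ha : IsUnit a) :
    Tendsto (fun k : ℕ => ∑' n : ℕ, {p : ℕ | p.Prime ∧ (p : ZMod q) = a}.indicator
      (fun p : ℕ => (p : ℝ) ^ (-(1 + (1 / 2 : ℝ) ^ k))) n) atTop atTop := by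
  obtain ⟨c, hc, C, hC0, hC⟩ := exists_tsum_prime_log_lower_bound ha
  set S : Set ℕ := {p : ℕ | p.Prime ∧ (p : ZMod q) = a} with hS
  set D : ℕ → ℝ := fun k => ∑' n : ℕ, S.indicator
    (fun p : ℕ => (p : ℝ) ^ (-(1 + (1 / 2 : ℝ) ^ k))) n with hD
  have hstep : ∀ k, D k + (c / 2 - C * (1 / 2 : ℝ) ^ (k + 1)) ≤ D (k + 1) := by
    intro k
    have hk : (0 : ℝ) < (1 / 2 : ℝ) ^ k := by positivity
    have hk1 : (1 / 2 : ℝ) ^ k ≤ 1 := pow_le_one₀ (by norm_num) (by norm_num)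
    have hk2 : (1 / 2 : ℝ) ^ (k + 1) = (1 / 2 : ℝ) ^ k / 2 := by rw [pow_succ]; ring
    obtain ⟨h1, h2⟩ := hC (1 + (1 / 2 : ℝ) ^ k) ⟨by linarith, by linarith⟩
    have h3 := summable_rpow_neg_of_one_lt (x := 1 + (1 / 2 : ℝ) ^ k) (by linarith) S
    have h4 := summable_rpow_neg_of_one_lt (x := 1 + (1 / 2 : ℝ) ^ (k + 1)) (by linarith) S
    have h5 := (h3.add (h2.mul_left ((1 / 2 : ℝ) ^ (k + 1)))).tsum_le_tsum (g := S.indicator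
      fun p : ℕ => (p : ℝ) ^ (-(1 + (1 / 2 : ℝ) ^ (k + 1)))) (fun n => ?_) h4
    · rw [h3.tsum_add (h2.mul_left _), tsum_mul_left] at h5
      have h6 := mul_le_mul_of_nonneg_left h1 (show (0 : ℝ) ≤ (1 / 2 : ℝ) ^ (k + 1) by positivity)
      have h7 : (1 / 2 : ℝ) ^ (k + 1) * (c / (1 + (1 / 2 : ℝ) ^ k - 1) - C) =
          c / 2 - C * (1 / 2 : ℝ) ^ (k + 1) := by
        rw [hk2, add_sub_cancel_left]
        field_simp
      simp only [hD]
      linarith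
    · by_cases hn : n ∈ S
      · simp only [Set.indicator_of_mem hn]
        have hn0 : (0 : ℝ) < n := by exact_mod_cast hn.1.pos
        have h8 : (n : ℝ) ^ (-(1 + (1 / 2 : ℝ) ^ (k + 1))) =
            (n : ℝ) ^ (-(1 + (1 / 2 : ℝ) ^ k)) * Real.exp (Real.log n * (1 / 2 : ℝ) ^ (k + 1)) := by
          rw [← Real.rpow_def_of_pos hn0, ← Real.rpow_add hn0, hk2]
          congr 1
          ring
        rw [h8]
        have h9 := mul_le_mul_of_nonneg_left (Real.add_one_le_exp
          (Real.log n * (1 / 2 : ℝ) ^ (k + 1))) (Real.rpow_nonneg hn0.le (-(1 + (1 / 2 : ℝ) ^ k)))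
        linarith
      · simp [Set.indicator_of_notMem hn]
  have hlow : ∀ k : ℕ, D 0 + k * (c / 2) - C * (1 - (1 / 2 : ℝ) ^ k) ≤ D k := by
    intro k
    induction k with
    | zero => simp
    | succ k ih =>
      have hk2 : (1 / 2 : ℝ) ^ (k + 1) = (1 / 2 : ℝ) ^ k / 2 := by rw [pow_succ]; ring
      have := hstep k
      rw [hk2] at this ⊢
      push_cast
      linarith
  refine tendsto_atTop_mono (f := fun k : ℕ => (k : ℝ) * (c / 2) + (D 0 - C)) (fun k => ?_) ?_
  · have : 0 ≤ C * (1 / 2 : ℝ) ^ k := by positivity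
    linarith [hlow k]
  · exact tendsto_atTop_add_const_right _ _
      (tendsto_natCast_atTop_atTop.atTop_mul_const (by positivity))

end PrimeSums

/-- A coefficient of an exponential polynomial is at most its supremum on a half-line. -/
theorem norm_coeff_le_of_norm_sum_exp_le {ι : Type*} [DecidableEq ι] (s : Finset ι) (c : ι → ℂ)
    (μ : ι → ℝ) (hμ : Set.InjOn μ s) {B T : ℝ}
    (hB : ∀ t ≥ T, ‖∑ a ∈ s, c a * Complex.exp (μ a * t * Complex.I)‖ ≤ B) {b : ι} (hb : b ∈ s) :
    ‖c b‖ ≤ B := by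
  set K : ℝ := ∑ a ∈ s.erase b, ‖c a‖ * (2 / |μ a - μ b|) with hK
  have hmain : ∀ X > 0, ‖c b‖ * X ≤ B * X + K := by
    intro X hX
    have hint : ∀ a, ∀ u v : ℝ, IntervalIntegrable
        (fun t : ℝ => c a * Complex.exp (((μ a - μ b : ℝ) * Complex.I) * t))
        MeasureTheory.volume u v := fun a u v => by
      apply Continuous.intervalIntegrable
      fun_prop
    have h1 : ‖∫ t in T..T + X, ∑ a ∈ s, c a * Complex.exp (((μ a - μ b : ℝ) * Complex.I) * t)‖ ≤
        B * |T + X - T| := by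
      refine intervalIntegral.norm_integral_le_of_norm_le_const fun t ht => ?_
      rw [Set.uIoc_of_le (by linarith)] at ht
      have h2 : ∑ a ∈ s, c a * Complex.exp (((μ a - μ b : ℝ) * Complex.I) * t) =
          (∑ a ∈ s, c a * Complex.exp (μ a * t * Complex.I)) *
            Complex.exp ((-(μ b * t) : ℝ) * Complex.I) := by
        rw [Finset.sum_mul]
        refine Finset.sum_congr rfl fun a _ => ?_
        rw [mul_assoc (c a), ← Complex.exp_add]
        congr 2
        push_cast
        ring
      rw [h2, norm_mul, Complex.norm_exp_ofReal_mul_I, mul_one]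
      exact hB t ht.1.le
    rw [intervalIntegral.integral_finsetSum fun a _ => hint a _ _,
      ← Finset.add_sum_erase _ _ hb, add_sub_cancel_left, abs_of_pos hX] at h1
    have h2 : ∫ t in T..T + X, c b * Complex.exp (((μ b - μ b : ℝ) * Complex.I) * t) = c b * X := by
      simp [mul_comm]
    have h3 : ‖∑ a ∈ s.erase b,
        ∫ t in T..T + X, c a * Complex.exp (((μ a - μ b : ℝ) * Complex.I) * t)‖ ≤ K := by
      refine norm_sum_le_of_le _ fun a ha => ?_
      have hne : μ a - μ b ≠ 0 := fun h => Finset.ne_of_mem_erase ha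
        (hμ (Finset.mem_of_mem_erase ha) hb (sub_eq_zero.1 h))
      rw [intervalIntegral.integral_const_mul, norm_mul]
      refine mul_le_mul_of_nonneg_left ?_ (norm_nonneg _)
      rw [integral_exp_mul_complex (mul_ne_zero (by exact_mod_cast hne) Complex.I_ne_zero),
        norm_div, norm_mul, Complex.norm_I, mul_one, Complex.norm_real, Real.norm_eq_abs]
      refine div_le_div_of_nonneg_right ((norm_sub_le _ _).trans ?_) (abs_nonneg _)
      have h4 : ∀ t : ℝ, ‖Complex.exp ((μ a - μ b : ℝ) * Complex.I * t)‖ = 1 := fun t => by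
        rw [mul_right_comm, ← Complex.ofReal_mul, Complex.norm_exp_ofReal_mul_I]
      rw [h4, h4]
      norm_num
    rw [h2] at h1
    have h4 : ‖c b * X‖ = ‖c b‖ * X := by rw [norm_mul, Complex.norm_of_nonneg hX.le]
    have h5 := norm_sub_norm_le (c b * (X : ℂ)) (-∑ a ∈ s.erase b,
        ∫ t in T..T + X, c a * Complex.exp (((μ a - μ b : ℝ) * Complex.I) * t))
    rw [sub_neg_eq_add, norm_neg] at h5
    linarith
  by_contra! h
  have hK0 : 0 ≤ K := Finset.sum_nonneg fun a _ => by positivity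
  have h1 := hmain ((K + 1) / (‖c b‖ - B)) (div_pos (by linarith) (by linarith))
  have h2 : (‖c b‖ - B) * ((K + 1) / (‖c b‖ - B)) = K + 1 := by
    field_simp [(sub_pos.2 h).ne']
  linarith

theorem injective_sum_log_primes {P : Finset ℕ} (hP : ∀ p ∈ P, p.Prime) :
    Function.Injective fun a : P → ℕ => ∑ p : P, (a p : ℝ) * Real.log (p : ℕ) := by
  intro a b hab
  have hlog : ∀ a : P → ℕ, ∑ p : P, (a p : ℝ) * Real.log (p : ℕ) =
      Real.log ((∏ p : P, (p : ℕ) ^ a p : ℕ) : ℝ) := fun a => by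
    rw [Nat.cast_prod, Real.log_prod fun p _ => by
      exact_mod_cast pow_ne_zero _ (hP p p.2).ne_zero]
    exact Finset.sum_congr rfl fun p _ => by rw [Nat.cast_pow, Real.log_pow]
  have hpos : ∀ a : P → ℕ, 0 < ∏ p : P, (p : ℕ) ^ a p := fun a =>
    Finset.prod_pos fun p _ => pow_pos (hP p p.2).pos _
  have hfac : ∀ (a : P → ℕ) (r : P), (∏ p : P, (p : ℕ) ^ a p).factorization r = a r := fun a r => by
    rw [Nat.factorization_prod (g := fun p : P => (p : ℕ) ^ a p)
      fun p _ => pow_ne_zero _ (hP p p.2).ne_zero, Finsupp.finsetSum_apply,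
      Finset.sum_eq_single r]
    · rw [(hP r r.2).factorization_pow, Finsupp.single_eq_same]
    · intro p _ hpr
      rw [(hP p p.2).factorization_pow, Finsupp.single_eq_of_ne fun h => hpr (Subtype.ext h.symm)]
    · simp
  have h1 : ∏ p : P, (p : ℕ) ^ a p = ∏ p : P, (p : ℕ) ^ b p := by
    have h2 := Real.log_injOn_pos (Set.mem_Ioi.2 (by exact_mod_cast hpos a))
      (Set.mem_Ioi.2 (by exact_mod_cast hpos b))
      ((hlog a).symm.trans (hab.trans (hlog b)))
    exact_mod_cast h2
  funext r
  rw [← hfac a r, h1, hfac b r]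

/-- Kronecker's theorem for the logarithms of the primes. -/
theorem exists_cpow_close_on_primes {P : Finset ℕ} (hP : ∀ p ∈ P, p.Prime) {ω : ℕ → ℂ}
    (hω : ∀ p ∈ P, ‖ω p‖ = 1) {ε : ℝ} (hε : 0 < ε) (T : ℝ) :
    ∃ τ ≥ T, ∀ p ∈ P, ‖(p : ℂ) ^ (-(τ * Complex.I)) - ω p‖ < ε := by
  classical
  by_contra! hcon
  have hcpow : ∀ p ∈ P, ∀ t : ℝ, (p : ℂ) ^ (-(t * Complex.I)) =
      Complex.exp ((-(Real.log p * t) : ℝ) * Complex.I) := fun p hp t => by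
    rw [Complex.cpow_def_of_ne_zero (by exact_mod_cast (hP p hp).ne_zero), ← Complex.natCast_log]
    congr 1
    push_cast
    ring
  let y : ℕ → ℝ → ℂ := fun p t => star (ω p) * (p : ℂ) ^ (-(t * Complex.I))
  have hcn : ∀ p ∈ P, ∀ t : ℝ, ‖(p : ℂ) ^ (-(t * Complex.I))‖ = 1 := fun p hp t => by
    rw [hcpow p hp, Complex.norm_exp_ofReal_mul_I]
  have hy1 : ∀ p ∈ P, ∀ t, ‖y p t‖ = 1 := fun p hp t => by
    simp only [y]
    rw [norm_mul, norm_star, hω p hp, hcn p hp, one_mul]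
  have hy2 : ∀ p ∈ P, ∀ t, ‖1 + y p t‖ ≤ 2 := fun p hp t =>
    (norm_add_le _ _).trans (by rw [hy1 p hp, norm_one]; norm_num)
  obtain ⟨r, hr0, hr1, hr⟩ : ∃ r : ℝ, 0 ≤ r ∧ r < 1 ∧
      ∀ z : ℂ, ‖z‖ = 1 → ε ≤ ‖1 - z‖ → ‖1 + z‖ ≤ 2 * r := by
    refine ⟨Real.sqrt (1 - ε ^ 2 / 4), Real.sqrt_nonneg _, ?_, fun z hz hzε => ?_⟩
    · rw [Real.sqrt_lt' one_pos]
      nlinarith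
    · have h1 := parallelogram_law_with_norm ℝ (1 : ℂ) z
      rw [norm_one, hz] at h1
      have h2 : ‖1 + z‖ / 2 ≤ Real.sqrt (1 - ε ^ 2 / 4) := Real.le_sqrt_of_sq_le (by nlinarith)
      linarith
  have hbound : ∀ N : ℕ, ∀ t ≥ T, ‖∏ p : P, (1 + y p t) ^ N‖ ≤ (2 ^ P.card * r) ^ N := by
    intro N t ht
    obtain ⟨p₀, hp₀, h0⟩ := hcon t ht
    rw [Finset.prod_pow, norm_pow, norm_prod]
    refine pow_le_pow_left₀ (Finset.prod_nonneg fun _ _ => norm_nonneg _) ?_ N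
    rw [Finset.prod_coe_sort P fun p => ‖1 + y p t‖, ← Finset.mul_prod_erase _ _ hp₀]
    have h1 : ‖1 + y p₀ t‖ ≤ 2 * r := by
      refine hr _ (hy1 p₀ hp₀ t) (h0.trans ?_)
      have h2 : star (ω p₀) * ω p₀ = 1 := by
        rw [Complex.star_def, Complex.conj_mul', hω p₀ hp₀]; norm_num
      have h3 : star (ω p₀) * ((p₀ : ℂ) ^ (-(t * Complex.I)) - ω p₀) = -(1 - y p₀ t) := by
        simp only [y]
        rw [mul_sub, h2]
        ring
      have h4 := congrArg norm h3
      rw [norm_mul, norm_star, hω p₀ hp₀, one_mul, norm_neg] at h4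
      exact h4.le
    have h5 : ∏ p ∈ P.erase p₀, ‖1 + y p t‖ ≤ 2 ^ (P.card - 1) := by
      rw [← Finset.card_erase_of_mem hp₀, ← Finset.prod_const]
      exact Finset.prod_le_prod (fun _ _ => norm_nonneg _)
        fun p hp => hy2 p (Finset.mem_of_mem_erase hp) t
    calc _ ≤ 2 * r * 2 ^ (P.card - 1) := mul_le_mul h1 h5 (Finset.prod_nonneg fun _ _ =>
          norm_nonneg _) (by positivity)
      _ = 2 ^ (P.card - 1 + 1) * r := by rw [pow_succ]; ring
      _ = _ := by rw [Nat.sub_add_cancel (Finset.card_pos.2 ⟨p₀, hp₀⟩)]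
  have hcount : ∀ N : ℕ, (1 : ℝ) ≤ ((N + 1 : ℕ) : ℝ) ^ P.card * r ^ N := by
    intro N
    let S : Finset (P → ℕ) := Fintype.piFinset fun _ => Finset.range (N + 1)
    let c : (P → ℕ) → ℂ := fun a => ∏ p : P, ((N.choose (a p) : ℂ) * star (ω p) ^ a p)
    let μ : (P → ℕ) → ℝ := fun a => -∑ p : P, (a p : ℝ) * Real.log (p : ℕ)
    have hexp : ∀ t : ℝ, ∏ p : P, (1 + y p t) ^ N =
        ∑ a ∈ S, c a * Complex.exp (μ a * t * Complex.I) := by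
      intro t
      have h1 : ∀ p : P, (1 + y p t) ^ N = ∑ j ∈ Finset.range (N + 1),
          (N.choose j : ℂ) * star (ω p) ^ j *
            Complex.exp ((j : ℂ) * ((-(Real.log (p : ℕ) * t) : ℝ) * Complex.I)) := fun p => by
        rw [add_comm, add_pow]
        refine Finset.sum_congr rfl fun j _ => ?_
        simp only [y]
        rw [hcpow p p.2, mul_pow, ← Complex.exp_nat_mul]
        ring
      simp_rw [h1]
      rw [Finset.prod_univ_sum]
      refine Finset.sum_congr rfl fun a _ => ?_
      rw [Finset.prod_mul_distrib, ← Complex.exp_sum]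
      congr 2
      simp only [μ]
      push_cast
      rw [neg_mul, neg_mul, Finset.sum_mul, Finset.sum_mul, ← Finset.sum_neg_distrib]
      exact Finset.sum_congr rfl fun p _ => by ring
    have hinj : Set.InjOn μ S := fun a _ b _ hab =>
      injective_sum_log_primes hP (neg_injective hab)
    have hcoef : ∀ a ∈ S, ‖c a‖ ≤ (2 ^ P.card * r) ^ N := fun a ha =>
      norm_coeff_le_of_norm_sum_exp_le S c μ hinj (fun t ht => by
        rw [← hexp]; exact hbound N t ht) ha
    have hcn : ∀ a, ‖c a‖ = ∏ p : P, (N.choose (a p) : ℝ) := fun a => by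
      simp only [c]
      rw [norm_prod]
      refine Finset.prod_congr rfl fun p _ => ?_
      rw [norm_mul, norm_pow, norm_star, hω p p.2, one_pow, mul_one, Complex.norm_natCast]
    have hsum : ∑ a ∈ S, ‖c a‖ = (2 ^ N) ^ P.card := by
      simp_rw [hcn]
      have h1 := Finset.prod_univ_sum (fun _ : P => Finset.range (N + 1))
        (fun _ j => (N.choose j : ℝ))
      have h2 : ∑ j ∈ Finset.range (N + 1), (N.choose j : ℝ) = 2 ^ N := by
        exact_mod_cast Nat.sum_range_choose N
      simp only [h2, Finset.prod_const, Finset.card_univ, Fintype.card_coe] at h1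
      exact h1.symm
    have h1 := Finset.sum_le_card_nsmul S _ _ hcoef
    have h2 : S.card = (N + 1) ^ P.card := by
      simp only [S]
      rw [Fintype.card_piFinset]
      simp
    rw [hsum, h2, nsmul_eq_mul, mul_pow, ← pow_mul, ← pow_mul, mul_comm N] at h1
    have h3 : (0 : ℝ) < 2 ^ (P.card * N) := by positivity
    push_cast at h1 ⊢
    refine le_of_mul_le_mul_left ?_ h3
    linarith
  have hlim := tendsto_pow_const_mul_const_pow_of_abs_lt_one P.card
    (show |r| < 1 by rwa [abs_of_nonneg hr0])
  have hlim2 := hlim.comp (tendsto_add_atTop_nat 1)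
  have hr2 : r ≤ 0 := ge_of_tendsto' hlim2 fun N => by
    simp only [Function.comp_apply]
    rw [pow_succ, ← mul_assoc]
    exact le_mul_of_one_le_left hr0 (hcount N)
  have h1 := hcount 1
  rw [le_antisymm hr2 hr0] at h1
  norm_num at h1

/-- A unimodular completely multiplicative function is a pointwise limit of functions `n ^ (-iτ)`
with arbitrarily large `τ`. -/
theorem exists_tendsto_cpow_of_unimodular (ω : ℕ →*₀ ℂ) (hω : ∀ n, n ≠ 0 → ‖ω n‖ = 1) :
    ∃ τ : ℕ → ℝ, Tendsto τ atTop atTop ∧ ∀ n : ℕ, n ≠ 0 →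
      Tendsto (fun j => (n : ℂ) ^ (-(τ j * Complex.I))) atTop (𝓝 (ω n)) := by
  have hex : ∀ j : ℕ, ∃ τ ≥ (j : ℝ), ∀ p ∈ (Finset.range j).filter Nat.Prime,
      ‖(p : ℂ) ^ (-(τ * Complex.I)) - ω p‖ < 1 / ((j : ℝ) + 1) := fun j =>
    exists_cpow_close_on_primes (fun p hp => (Finset.mem_filter.1 hp).2)
      (fun p hp => hω p (Finset.mem_filter.1 hp).2.ne_zero) (by positivity) _
  choose τ hτ hclose using hex
  refine ⟨τ, tendsto_atTop_mono hτ tendsto_natCast_atTop_atTop, fun n => ?_⟩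
  induction n using induction_on_primes with
  | zero => exact fun h => absurd rfl h
  | one => simp
  | prime_mul p n hp ih =>
    intro hpn
    have hn : n ≠ 0 := (mul_ne_zero_iff.1 hpn).2
    have h1 : Tendsto (fun j => (p : ℂ) ^ (-(τ j * Complex.I))) atTop (𝓝 (ω p)) := by
      rw [tendsto_iff_norm_sub_tendsto_zero]
      refine squeeze_zero' (Eventually.of_forall fun _ => norm_nonneg _) ?_
        tendsto_one_div_add_atTop_nhds_zero_nat
      filter_upwards [eventually_gt_atTop p] with j hj
      exact (hclose j p (Finset.mem_filter.2 ⟨Finset.mem_range.2 hj, hp⟩)).le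
    rw [map_mul]
    refine (h1.mul (ih hn)).congr fun j => ?_
    rw [Nat.cast_mul, Complex.natCast_mul_natCast_cpow]

/-- The product of a Dirichlet character and a completely multiplicative function. -/
noncomputable def characterTwist {N : ℕ} (χ : DirichletCharacter ℂ N) (g : ℕ →*₀ ℂ) : ℕ →*₀ ℂ where
  toFun n := χ n * g n
  map_zero' := by simp
  map_one' := by simp
  map_mul' m n := by
    rw [Nat.cast_mul, map_mul, map_mul]
    ring

theorem characterTwist_apply {N : ℕ} (χ : DirichletCharacter ℂ N) (g : ℕ →*₀ ℂ) (n : ℕ) :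
    characterTwist χ g n = χ n * g n := rfl

theorem summable_norm_characterTwist {N : ℕ} (χ : DirichletCharacter ℂ N) {g : ℕ →*₀ ℂ}
    (hg : Summable fun n => ‖g n‖) : Summable fun n => ‖characterTwist χ g n‖ :=
  hg.of_nonneg_of_le (fun _ => norm_nonneg _) fun n => by
    rw [characterTwist_apply, norm_mul]
    exact mul_le_of_le_one_left (norm_nonneg _) (χ.norm_le_one n)

theorem norm_lt_one_of_summable {g : ℕ →*₀ ℂ} (hg : Summable fun n => ‖g n‖) {p : ℕ}
    (hp : p.Prime) : ‖g p‖ < 1 :=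
  Summable.norm_lt_one (f := g.toMonoidHom) hg.of_norm hp.one_lt

theorem one_sub_ne_zero_of_norm_lt_one {z : ℂ} (hz : ‖z‖ < 1) : 1 - z ≠ 0 := fun h => by
  rw [← sub_eq_zero.1 h, norm_one] at hz
  exact lt_irrefl _ hz

/-- Changing a completely multiplicative function at finitely many primes changes its sum by the
corresponding Euler factors. -/
theorem tsum_mul_prod_one_sub_eq {F G : ℕ →*₀ ℂ} (hF : Summable fun n => ‖F n‖)
    (hG : Summable fun n => ‖G n‖) {S : Finset ℕ} (hS : ∀ p ∈ S, p.Prime)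
    (hFG : ∀ p, p.Prime → p ∉ S → F p = G p) :
    (∑' n, F n) * ∏ p ∈ S, (1 - F p) = (∑' n, G n) * ∏ p ∈ S, (1 - G p) := by
  have hlim : ∀ {H : ℕ →*₀ ℂ}, Summable (fun n => ‖H n‖) →
      Tendsto (fun n : ℕ => ∏ p ∈ n.primesBelow \ S, (1 - H p)⁻¹) atTop
        (𝓝 ((∑' n, H n) * ∏ p ∈ S, (1 - H p))) := by
    intro H hH
    have h1 := (EulerProduct.eulerProduct_completely_multiplicative hH).mul_const
      (∏ p ∈ S, (1 - H p))
    refine h1.congr' ?_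
    filter_upwards [eventually_gt_atTop (S.sup id)] with n hn
    have hSn : S ⊆ n.primesBelow := fun p hp =>
      Nat.mem_primesBelow.2 ⟨(Finset.le_sup (f := id) hp).trans_lt hn, hS p hp⟩
    rw [← Finset.prod_sdiff hSn, mul_assoc, ← Finset.prod_mul_distrib,
      Finset.prod_eq_one (s := S), mul_one]
    intro p hp
    exact inv_mul_cancel₀ (one_sub_ne_zero_of_norm_lt_one (norm_lt_one_of_summable hH (hS p hp)))
  refine tendsto_nhds_unique (hlim hF) ((hlim hG).congr fun n => ?_)
  refine Finset.prod_congr rfl fun p hp => ?_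
  rw [Finset.mem_sdiff] at hp
  rw [hFG p (Nat.prime_of_mem_primesBelow hp.1) hp.2]

/-- The expansion of a periodic function into dilated Dirichlet characters. -/
theorem exists_character_expansion {q : ℕ} [NeZero q] (a : ZMod q → ℂ) :
    ∃ (I : Type) (_ : Fintype I) (D N : I → ℕ) (ψ : ∀ i, DirichletCharacter ℂ (N i)) (c : I → ℂ),
      (∀ i, D i ∣ q ∧ N i ∣ q) ∧
      ∀ n : ℕ, a n = ∑ i, if D i ∣ n then c i * ψ i (n / D i : ℕ) else 0 := by
  classical
  have hq : q ≠ 0 := NeZero.ne q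
  have hdiv : ∀ d : q.divisors, (d : ℕ) ∣ q := fun d => Nat.dvd_of_mem_divisors d.2
  have hNe : ∀ d : q.divisors, NeZero (q / (d : ℕ)) := fun d =>
    ⟨(Nat.div_pos (Nat.le_of_dvd (NeZero.pos q) (hdiv d)) (Nat.pos_of_dvd_of_pos (hdiv d)
      (NeZero.pos q))).ne'⟩
  let κ : ∀ d : q.divisors, DirichletCharacter ℂ (q / (d : ℕ)) → ℂ := fun d ψ =>
    ((q / (d : ℕ)).totient : ℂ)⁻¹ * ∑ b : ZMod (q / (d : ℕ)), if IsUnit b then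
      ψ b⁻¹ * a ((d : ℕ) * b.val : ℕ) else 0
  refine ⟨Σ d : q.divisors, DirichletCharacter ℂ (q / (d : ℕ)), inferInstance, fun i => i.1,
    fun i => q / i.1, fun i => i.2, fun i => κ i.1 i.2,
    fun i => ⟨hdiv i.1, Nat.div_dvd_of_dvd (hdiv i.1)⟩, fun n => ?_⟩
  have hinner : ∀ d : q.divisors, ∀ m : ℕ, ∑ ψ : DirichletCharacter ℂ (q / (d : ℕ)), κ d ψ * ψ m =
      if IsUnit ((m : ℕ) : ZMod (q / (d : ℕ))) then a ((d : ℕ) * m : ℕ) else 0 := by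
    intro d m
    have := hNe d
    have hφ : ((q / (d : ℕ)).totient : ℂ) ≠ 0 := by
      exact_mod_cast (Nat.totient_pos.2 (NeZero.pos _)).ne'
    split_ifs with hm
    · have h1 : ∀ ψ : DirichletCharacter ℂ (q / (d : ℕ)), κ d ψ * ψ m =
          ∑ b : ZMod (q / (d : ℕ)), if IsUnit b then ((q / (d : ℕ)).totient : ℂ)⁻¹ *
            (a ((d : ℕ) * b.val : ℕ) * (ψ b⁻¹ * ψ m)) else 0 := fun ψ => by
        simp only [κ]
        rw [mul_assoc, Finset.sum_mul, Finset.mul_sum]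
        refine Finset.sum_congr rfl fun b _ => ?_
        split_ifs
        · ring
        · ring
      simp_rw [h1]
      rw [Finset.sum_comm, Finset.sum_eq_single ((m : ℕ) : ZMod (q / (d : ℕ)))]
      · simp only [hm, if_true]
        rw [← Finset.mul_sum, ← Finset.mul_sum, DirichletCharacter.sum_char_inv_mul_char_eq ℂ hm,
          if_pos rfl, mul_comm, mul_assoc, mul_inv_cancel₀ hφ, mul_one, ZMod.val_natCast]
        congr 1
        rw [ZMod.natCast_eq_natCast_iff]
        have h2 := (Nat.mod_modEq m (q / (d : ℕ))).mul_left' (d : ℕ)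
        rwa [Nat.mul_div_cancel' (hdiv d)] at h2
      · intro b _ hb
        split_ifs with hbu
        · rw [← Finset.mul_sum, ← Finset.mul_sum,
            DirichletCharacter.sum_char_inv_mul_char_eq ℂ hbu, if_neg hb, mul_zero, mul_zero]
        · simp
      · simp
    · exact Finset.sum_eq_zero fun ψ _ => by rw [MulChar.map_nonunit _ hm, mul_zero]
  rw [Fintype.sum_sigma]
  have hsum : ∀ d : q.divisors, (∑ ψ : DirichletCharacter ℂ (q / (d : ℕ)),
      if (d : ℕ) ∣ n then κ d ψ * ψ (n / (d : ℕ) : ℕ) else 0) =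
      if (d : ℕ) = q.gcd n then a n else 0 := by
    intro d
    have hd0 : 0 < (d : ℕ) := Nat.pos_of_dvd_of_pos (hdiv d) (NeZero.pos q)
    by_cases hdn : (d : ℕ) ∣ n
    · simp only [hdn, if_true]
      rw [hinner, Nat.mul_div_cancel' hdn]
      refine if_congr ?_ rfl rfl
      rw [ZMod.isUnit_iff_coprime, Nat.coprime_comm, Nat.Coprime, Nat.gcd_div (hdiv d) hdn]
      constructor
      · intro h
        exact (Nat.eq_of_dvd_of_div_eq_one (Nat.dvd_gcd (hdiv d) hdn) h)
      · intro h
        rw [← h, Nat.div_self hd0]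
    · simp only [hdn, if_false, Finset.sum_const_zero]
      rw [if_neg]
      intro h
      exact hdn (h ▸ Nat.gcd_dvd_right q n)
  simp_rw [hsum]
  rw [Finset.sum_eq_single ⟨q.gcd n, Nat.mem_divisors.2 ⟨Nat.gcd_dvd_left q n, hq⟩⟩]
  · simp
  · intro d _ hd
    rw [if_neg]
    exact fun h => hd (Subtype.ext h)
  · simp

section Decomposition

variable {q : ℕ} [NeZero q] {I : Type} [Fintype I] {D N : I → ℕ}

open DirichletCharacter in
/-- The factor of the `L`-function of `χ` in the decomposition of a Dirichlet series with periodic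
coefficients; it only depends on the values of `g` at divisors of `q`. -/
noncomputable def localFactor (hN : ∀ i, N i ∣ q) (D : I → ℕ) (ψ : ∀ i, DirichletCharacter ℂ (N i))
    (c : I → ℂ) (χ : DirichletCharacter ℂ q) (g : ℕ → ℂ) : ℂ :=
  open Classical in ∑ i with changeLevel (hN i) (ψ i) = χ,
    c i * g (D i) * ∏ p ∈ q.primeFactors, (1 - ψ i p * g p)⁻¹

theorem hasSum_ite_dvd {F : ℕ → ℂ} {d : ℕ} (hd : d ≠ 0) {S : ℂ} (hF : HasSum F S) :
    HasSum (fun n => if d ∣ n then F (n / d) else 0) S := by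
  have hinj : Function.Injective fun k : ℕ => d * k := fun _ _ h =>
    Nat.eq_of_mul_eq_mul_left (Nat.pos_of_ne_zero hd) h
  refine (hinj.hasSum_iff fun n hn => ?_).1 ?_
  · rw [if_neg]
    rintro ⟨k, rfl⟩
    exact hn ⟨k, rfl⟩
  · simpa [Function.comp_def, Nat.mul_div_cancel_left _ (Nat.pos_of_ne_zero hd)] using hF

theorem coprime_of_prime_of_notMem_primeFactors {p : ℕ} (hp : p.Prime) (h : p ∉ q.primeFactors) :
    p.Coprime q :=
  (Nat.Prime.coprime_iff_not_dvd hp).2 fun hd => h (Nat.mem_primeFactors.2 ⟨hp, hd, NeZero.ne q⟩)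

theorem changeLevel_apply_of_coprime {M m : ℕ} (h : M ∣ m) (ψ : DirichletCharacter ℂ M) {p : ℕ}
    (hp : p.Coprime m) : DirichletCharacter.changeLevel h ψ p = ψ p := by
  have := DirichletCharacter.changeLevel_eq_cast_of_dvd' ψ h (a := (p : ℤ))
    (Nat.isCoprime_iff_coprime.2 hp)
  simpa using this

theorem character_apply_of_prime_dvd {M : ℕ} (χ : DirichletCharacter ℂ M) {p : ℕ}
    (hp : p.Prime) (h : p ∣ M) : χ p = 0 :=
  MulChar.map_nonunit _ fun hu => by
    rw [ZMod.isUnit_iff_coprime, hp.coprime_iff_not_dvd] at hu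
    exact hu h

theorem tsum_characterTwist_changeLevel {M : ℕ} (h : M ∣ q) (ψ : DirichletCharacter ℂ M)
    {g : ℕ →*₀ ℂ} (hg : Summable fun n => ‖g n‖) :
    ∑' n, characterTwist (DirichletCharacter.changeLevel h ψ) g n =
      (∑' n, characterTwist ψ g n) * ∏ p ∈ q.primeFactors, (1 - ψ p * g p) := by
  have h4 := tsum_mul_prod_one_sub_eq (summable_norm_characterTwist ψ hg)
    (summable_norm_characterTwist (DirichletCharacter.changeLevel h ψ) hg)
    (fun p => Nat.prime_of_mem_primeFactors) (fun p hp hpq => by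
      rw [characterTwist_apply, characterTwist_apply, changeLevel_apply_of_coprime _ _
        (coprime_of_prime_of_notMem_primeFactors hp hpq)])
  rw [Finset.prod_eq_one (f := fun p => 1 - characterTwist (DirichletCharacter.changeLevel h
    ψ) g p), mul_one] at h4
  · exact h4.symm
  · intro p hp
    rw [characterTwist_apply, character_apply_of_prime_dvd _
      (Nat.prime_of_mem_primeFactors hp) (Nat.dvd_of_mem_primeFactors hp), zero_mul, sub_zero]

theorem tsum_periodic_mul_eq (hN : ∀ i, N i ∣ q) (hD : ∀ i, D i ∣ q)
    (ψ : ∀ i, DirichletCharacter ℂ (N i)) (c : I → ℂ) {a : ZMod q → ℂ}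
    (ha : ∀ n : ℕ, a n = ∑ i, if D i ∣ n then c i * ψ i (n / D i : ℕ) else 0)
    {g : ℕ →*₀ ℂ} (hg : Summable fun n => ‖g n‖) :
    ∑' n : ℕ, a n * g n =
      ∑ χ : DirichletCharacter ℂ q, localFactor hN D ψ c χ g * ∑' n, characterTwist χ g n := by
  classical
  have h1 : ∀ i, HasSum (fun n : ℕ => (if D i ∣ n then c i * ψ i (n / D i : ℕ) else 0) * g n)
      (c i * g (D i) * ∑' n, characterTwist (ψ i) g n) := fun i => by
    have hd : D i ≠ 0 := fun h => NeZero.ne q (Nat.eq_zero_of_zero_dvd (h ▸ hD i))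
    refine ((hasSum_ite_dvd hd
      ((summable_norm_characterTwist (ψ i) hg).of_norm.hasSum)).mul_left (c i * g (D i))).congr_fun
      fun n => ?_
    split_ifs with hn
    · obtain ⟨m, rfl⟩ := hn
      rw [Nat.mul_div_cancel_left _ (Nat.pos_of_ne_zero hd), characterTwist_apply, map_mul]
      ring
    · simp
  have h2 : HasSum (fun n : ℕ => a n * g n)
      (∑ i, c i * g (D i) * ∑' n, characterTwist (ψ i) g n) := by
    simp_rw [ha, Finset.sum_mul]
    exact hasSum_sum fun i _ => h1 i
  rw [h2.tsum_eq]
  have h3 : ∀ i, ∑' n, characterTwist (ψ i) g n =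
      (∑' n, characterTwist (DirichletCharacter.changeLevel (hN i) (ψ i)) g n) *
        ∏ p ∈ q.primeFactors, (1 - ψ i p * g p)⁻¹ := fun i => by
    have hne : ∏ p ∈ q.primeFactors, (1 - ψ i p * g p) ≠ 0 := Finset.prod_ne_zero_iff.2
      fun p hp => one_sub_ne_zero_of_norm_lt_one (norm_lt_one_of_summable
        (summable_norm_characterTwist (ψ i) hg) (Nat.prime_of_mem_primeFactors hp))
    rw [Finset.prod_inv_distrib, ← div_eq_mul_inv, eq_div_iff hne,
      tsum_characterTwist_changeLevel (hN i) _ hg]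
  rw [← Finset.sum_fiberwise Finset.univ fun i => DirichletCharacter.changeLevel (hN i) (ψ i)]
  refine Finset.sum_congr rfl fun χ _ => ?_
  rw [localFactor, Finset.sum_mul]
  refine Finset.sum_congr (by congr) fun i hi => ?_
  rw [h3, (Finset.mem_filter.1 hi).2]
  ring

open DirichletCharacter in
theorem changeLevel_conductor_eq {M : ℕ} (h : M ∣ q) {ψ : DirichletCharacter ℂ M}
    {χ : DirichletCharacter ℂ q} (hψ : changeLevel h ψ = χ) :
    ∃ hd : χ.conductor ∣ M, ψ = changeLevel hd χ.primitiveCharacter := by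
  have hd : χ.conductor ∣ M := conductor_dvd_of_mem_conductorSet χ
    ((mem_conductorSet_iff χ).2 ⟨h, ψ, hψ.symm⟩)
  refine ⟨hd, changeLevel_injective h ?_⟩
  rw [← changeLevel_trans _ hd h, hψ, changeLevel_primitiveCharacter]

theorem localFactor_mul_tsum_eq (hN : ∀ i, N i ∣ q) (ψ : ∀ i, DirichletCharacter ℂ (N i))
    (c : I → ℂ) (χ : DirichletCharacter ℂ q) {g : ℕ →*₀ ℂ} (hg : Summable fun n => ‖g n‖) :
    open Classical in
    localFactor hN D ψ c χ g * ∑' n, characterTwist χ g n =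
      (∑ i with DirichletCharacter.changeLevel (hN i) (ψ i) = χ, c i * g (D i) *
        ∏ p ∈ q.primeFactors, (1 - (if p ∣ N i then χ.primitiveCharacter p else 0) * g p)) *
      ∑' n, characterTwist χ.primitiveCharacter g n := by
  classical
  have h1 := tsum_characterTwist_changeLevel χ.conductor_dvd_level χ.primitiveCharacter hg
  rw [DirichletCharacter.changeLevel_primitiveCharacter] at h1
  rw [h1, localFactor, Finset.sum_mul, Finset.sum_mul]
  refine Finset.sum_congr (by congr) fun i hi => ?_
  obtain ⟨hd, hψ⟩ := changeLevel_conductor_eq (hN i) (Finset.mem_filter.1 hi).2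
  have h2 : ∏ p ∈ q.primeFactors, (1 - (if p ∣ N i then χ.primitiveCharacter p else 0) * g p) =
      (∏ p ∈ q.primeFactors, (1 - ψ i p * g p)⁻¹) *
        ∏ p ∈ q.primeFactors, (1 - χ.primitiveCharacter p * g p) := by
    rw [← Finset.prod_mul_distrib]
    refine Finset.prod_congr rfl fun p hp => ?_
    have hpp := Nat.prime_of_mem_primeFactors hp
    split_ifs with hpN
    · rw [character_apply_of_prime_dvd _ hpp hpN]
      simp
    · rw [hψ, changeLevel_apply_of_coprime _ _ ((Nat.Prime.coprime_iff_not_dvd hpp).2 hpN),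
        inv_mul_cancel₀, zero_mul, sub_zero]
      exact one_sub_ne_zero_of_norm_lt_one (norm_lt_one_of_summable
        (summable_norm_characterTwist χ.primitiveCharacter hg) hpp)
  rw [h2]
  ring

theorem differentiableOn_localFactor (hN : ∀ i, N i ∣ q) (hD : ∀ i, D i ∣ q)
    (ψ : ∀ i, DirichletCharacter ℂ (N i)) (c : I → ℂ) (χ : DirichletCharacter ℂ q) :
    DifferentiableOn ℂ (fun s : ℂ => localFactor hN D ψ c χ fun n => (n : ℂ) ^ (-s))
      {s | 0 < s.re} := by
  classical
  unfold localFactor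
  have hpow : ∀ n : ℕ, n ≠ 0 → Differentiable ℂ fun s : ℂ => (n : ℂ) ^ (-s) := fun n hn =>
    differentiable_neg.const_cpow (Or.inl (Nat.cast_ne_zero.2 hn))
  refine DifferentiableOn.fun_sum fun i _ => DifferentiableOn.fun_mul ?_ ?_
  · exact ((hpow _ fun h => NeZero.ne q (Nat.eq_zero_of_zero_dvd (h ▸ hD i))).const_mul
      _).differentiableOn
  · refine DifferentiableOn.fun_finsetProd fun p hp => DifferentiableOn.fun_inv ?_ fun s hs => ?_
    · exact ((differentiable_const _).sub ((hpow _ (Nat.prime_of_mem_primeFactors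
        hp).ne_zero).const_mul _)).differentiableOn
    · have hpp := Nat.prime_of_mem_primeFactors hp
      refine one_sub_ne_zero_of_norm_lt_one ?_
      rw [norm_mul]
      refine (mul_le_of_le_one_left (norm_nonneg _) ((ψ i).norm_le_one _)).trans_lt ?_
      rw [Complex.norm_natCast_cpow_of_pos hpp.pos]
      exact Real.rpow_lt_one_of_one_lt_of_neg (by exact_mod_cast hpp.one_lt)
        (by simpa using hs)

end Decomposition

/-- The function `s ↦ n ^ (-s)`, as a monoid homomorphism in `n`. -/
noncomputable def dirichletMonomial : ℕ+ →* (ℂ → ℂ) where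
  toFun n s := (n : ℂ) ^ (-s)
  map_one' := by
    ext s
    simp
  map_mul' m n := by
    ext s
    simp only [PNat.mul_coe, Nat.cast_mul, Pi.mul_apply]
    exact Complex.natCast_mul_natCast_cpow _ _ _

/-- The algebra of Dirichlet polynomials. -/
noncomputable def dirichletPolynomials : Subalgebra ℂ (ℂ → ℂ) :=
  (MonoidAlgebra.lift ℂ (ℂ → ℂ) ℕ+ dirichletMonomial).range

theorem dirichletMonomial_mem {n : ℕ} (hn : n ≠ 0) :
    (fun s : ℂ => (n : ℂ) ^ (-s)) ∈ dirichletPolynomials :=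
  ⟨MonoidAlgebra.of ℂ ℕ+ (n.toPNat (Nat.pos_of_ne_zero hn)),
    MonoidAlgebra.lift_of dirichletMonomial _⟩

theorem exists_coeff_of_mem_dirichletPolynomials {P : ℂ → ℂ} (hP : P ∈ dirichletPolynomials) :
    ∃ (𝒩 : Finset ℕ) (_ : 𝒩.Nonempty) (_ : ∀ n ∈ 𝒩, 0 < n) (a : ℕ → ℂ),
      ∀ s, P s = ∑ n ∈ 𝒩, a n * (n : ℂ) ^ (-s) := by
  classical
  obtain ⟨x, rfl⟩ := hP
  refine ⟨(insert 1 x.coeff.support).map ⟨_, PNat.coe_injective⟩, ⟨1, ?_⟩, ?_,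
    fun n => x.coeff n.toPNat', fun s => ?_⟩
  · exact Finset.mem_map.2 ⟨1, Finset.mem_insert_self _ _, rfl⟩
  · intro n hn
    obtain ⟨m, -, rfl⟩ := Finset.mem_map.1 hn
    exact m.pos
  · rw [Finset.sum_map]
    change (MonoidAlgebra.lift ℂ (ℂ → ℂ) ℕ+ dirichletMonomial) x s = _
    rw [MonoidAlgebra.lift_apply, Finsupp.sum_of_support_subset _ (Finset.subset_insert 1 _) _
      (by simp), Finset.sum_apply]
    refine Finset.sum_congr rfl fun n _ => ?_
    simp [dirichletMonomial]

section Decomposition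

variable {q : ℕ} [NeZero q] {I : Type} [Fintype I] {D N : I → ℕ}

theorem exists_dirichletPolynomial_of_localFactor_eq_zero (hN : ∀ i, N i ∣ q) (hD : ∀ i, D i ∣ q)
    (ψ : ∀ i, DirichletCharacter ℂ (N i)) (c : I → ℂ) {a : ZMod q → ℂ}
    (ha : ∀ n : ℕ, a n = ∑ i, if D i ∣ n then c i * ψ i (n / D i : ℕ) else 0)
    (χ₀ : DirichletCharacter ℂ q) (h0 : ∀ χ, χ ≠ χ₀ → ∀ s : ℂ, 1 < s.re →
      localFactor hN D ψ c χ (fun n => (n : ℂ) ^ (-s)) = 0) :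
    ∃ P ∈ dirichletPolynomials, ∀ s : ℂ, 1 < s.re →
      ∑' n : ℕ, a n * (n : ℂ) ^ (-s) =
        P s * ∑' n : ℕ, χ₀.primitiveCharacter n * (n : ℂ) ^ (-s) := by
  classical
  refine ⟨fun s => ∑ i with DirichletCharacter.changeLevel (hN i) (ψ i) = χ₀,
    c i * ((D i : ℕ) : ℂ) ^ (-s) * ∏ p ∈ q.primeFactors,
      (1 - (if p ∣ N i then χ₀.primitiveCharacter p else 0) * (p : ℂ) ^ (-s)), ?_, fun s hs => ?_⟩
  · have hP : (∑ i with DirichletCharacter.changeLevel (hN i) (ψ i) = χ₀,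
        (c i • fun s : ℂ => ((D i : ℕ) : ℂ) ^ (-s)) * ∏ p ∈ q.primeFactors,
          ((1 : ℂ → ℂ) - (if p ∣ N i then χ₀.primitiveCharacter p else 0) •
            fun s : ℂ => (p : ℂ) ^ (-s))) ∈ dirichletPolynomials := by
      refine sum_mem fun i _ => mul_mem (Subalgebra.smul_mem _ (dirichletMonomial_mem ?_) _)
        (prod_mem fun p hp => sub_mem (one_mem _) (Subalgebra.smul_mem _ (dirichletMonomial_mem
          (Nat.prime_of_mem_primeFactors hp).ne_zero) _))
      exact fun h => NeZero.ne q (Nat.eq_zero_of_zero_dvd (h ▸ hD i))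
    convert hP using 1
    ext s
    simp only [Finset.sum_apply, Finset.prod_apply, Pi.mul_apply, Pi.sub_apply, Pi.smul_apply,
      Pi.one_apply, smul_eq_mul]
  · have hg : Summable fun n => ‖riemannZetaSummandHom (Complex.ne_zero_of_one_lt_re hs) n‖ :=
      summable_riemannZetaSummand hs
    refine (tsum_periodic_mul_eq hN hD ψ c ha hg).trans ?_
    rw [Finset.sum_eq_single χ₀]
    · exact localFactor_mul_tsum_eq hN ψ c χ₀ hg
    · intro χ _ hχ
      rw [show localFactor hN D ψ c χ (riemannZetaSummandHom (Complex.ne_zero_of_one_lt_re hs)) = 0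
        from h0 χ hχ s hs, zero_mul]
    · simp

end Decomposition

theorem exists_ne_zero_on_vertical_line {F G : ℂ → ℂ} (hF : DifferentiableOn ℂ F {s | 0 < s.re})
    (hG : DifferentiableOn ℂ G {s | 0 < s.re}) (hF0 : ∃ s : ℂ, 0 < s.re ∧ F s ≠ 0)
    (hG0 : ∃ s : ℂ, 0 < s.re ∧ G s ≠ 0) :
    ∃ t : ℝ, F (1 + t * Complex.I) ≠ 0 ∧ G (1 + t * Complex.I) ≠ 0 := by
  by_contra! hcon
  have hopen : IsOpen {s : ℂ | 0 < s.re} := isOpen_lt continuous_const Complex.continuous_re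
  have hconn : IsPreconnected {s : ℂ | 0 < s.re} := (convex_halfSpace_re_gt 0).isPreconnected
  have hFa := hF.analyticOnNhd hopen
  have hGa := hG.analyticOnNhd hopen
  have hline : Tendsto (fun t : ℝ => (1 : ℂ) + t * Complex.I) (𝓝[≠] 0) (𝓝[≠] 1) := by
    refine tendsto_nhdsWithin_iff.2 ⟨?_, ?_⟩
    · refine ((Continuous.tendsto' (by fun_prop) 0 1 (by simp)) : Tendsto
        (fun t : ℝ => (1 : ℂ) + t * Complex.I) (𝓝 0) (𝓝 1)).mono_left nhdsWithin_le_nhds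
    · filter_upwards [self_mem_nhdsWithin] with t ht
      simpa using ht
  have hfreq : ∃ᶠ z in 𝓝[≠] (1 : ℂ), (F * G) z = 0 := by
    refine hline.frequently (Eventually.frequently (Eventually.of_forall fun t => ?_))
    by_cases h : F (1 + t * Complex.I) = 0
    · simp [h]
    · simp [hcon t h]
  have hzero := (hFa.mul hGa).eqOn_zero_of_preconnected_of_frequently_eq_zero hconn
    (by simp) hfreq
  obtain ⟨s₁, hs₁, h₁⟩ := hF0
  obtain ⟨s₂, hs₂, h₂⟩ := hG0
  rcases hFa.eq_zero_or_eq_zero_of_mul_eq_zero hGa hzero hconn with h | h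
  · exact h₁ (h s₁ hs₁)
  · exact h₂ (h s₂ hs₂)

theorem exists_ne_of_not_forall_eq_zero {α β : Type*} [Nonempty α] {Q : α → β → ℂ}
    (h : ∀ x₀, ¬ ∀ x, x ≠ x₀ → ∀ y, Q x y = 0) :
    ∃ x₁ x₂, x₁ ≠ x₂ ∧ (∃ y, Q x₁ y ≠ 0) ∧ ∃ y, Q x₂ y ≠ 0 := by
  obtain ⟨x₀⟩ := ‹Nonempty α›
  have h0 := h x₀
  push Not at h0
  obtain ⟨x₁, -, h₁⟩ := h0
  have h1 := h x₁
  push Not at h1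
  obtain ⟨x₂, hne, h₂⟩ := h1
  exact ⟨x₁, x₂, hne.symm, h₁, h₂⟩

theorem tendsto_tsum_mul_prod_one_sub {F : ℕ →*₀ ℂ} (hF : Summable fun n => ‖F n‖)
    (h0 : ∑' n, F n ≠ 0) {S : Finset ℕ} (hS : ∀ p ∈ S, F p = 0) :
    Tendsto (fun Y : ℕ => (∑' n, F n) * ∏ p ∈ Y.primesBelow \ S, (1 - F p)) atTop (𝓝 1) := by
  have h1 := ((EulerProduct.eulerProduct_completely_multiplicative hF).inv₀ h0).const_mul
    (∑' n, F n)
  rw [mul_inv_cancel₀ h0] at h1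
  refine h1.congr fun Y => ?_
  rw [Finset.prod_inv_distrib, inv_inv]
  congr 1
  refine (Finset.prod_subset Finset.sdiff_subset fun p hp hpS => ?_).symm
  rw [hS p (by simpa [hp] using hpS), sub_zero]

theorem tsum_characterTwist_ne_zero {q : ℕ} (χ : DirichletCharacter ℂ q) {s : ℂ}
    (hs : 1 < s.re) (h0 : s ≠ 0) :
    ∑' n, characterTwist χ (riemannZetaSummandHom h0) n ≠ 0 := by
  refine ne_of_eq_of_ne (tsum_congr fun n => ?_) (χ.LSeries_ne_zero_of_one_lt_re hs)
  rw [characterTwist_apply, LSeries.term_def]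
  split_ifs with hn
  · rw [hn, map_zero, mul_zero]
  · change χ n * (n : ℂ) ^ (-s) = _
    rw [Complex.cpow_neg, div_eq_mul_inv]

theorem exists_monoidWithZeroHom_eq_on_primes {u : ℕ → ℂ} (hu : ∀ p, ‖u p‖ = 1) :
    ∃ ω : ℕ →*₀ ℂ, (∀ n, n ≠ 0 → ‖ω n‖ = 1) ∧ ∀ p : ℕ, p.Prime → ω p = u p := by
  refine ⟨{ toFun := fun n => if n = 0 then 0 else n.factorization.prod fun p k => u p ^ k
            map_zero' := by simp
            map_one' := by simp
            map_mul' := fun m n => ?_ }, fun n hn => ?_, fun p hp => ?_⟩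
  · rcases eq_or_ne m 0 with rfl | hm
    · simp
    rcases eq_or_ne n 0 with rfl | hn
    · simp
    simp only [mul_eq_zero, hm, hn, or_self, if_false]
    rw [Nat.factorization_mul hm hn]
    exact Finsupp.prod_add_index' (fun _ => pow_zero _) fun _ _ _ => pow_add _ _ _
  · change ‖if n = 0 then 0 else n.factorization.prod fun p k => u p ^ k‖ = 1
    rw [if_neg hn, Finsupp.prod, norm_prod]
    exact Finset.prod_eq_one fun p _ => by rw [norm_pow, hu, one_pow]
  · change (if p = 0 then 0 else p.factorization.prod fun p k => u p ^ k) = u p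
    rw [if_neg hp.ne_zero, hp.factorization, Finsupp.prod_single_index
      (h := fun p k => u p ^ k) (pow_zero _), pow_one]

theorem monoidWithZeroHom_eq_of_eq_on_primeFactors {F G : ℕ →*₀ ℂ} {n : ℕ} (hn : n ≠ 0)
    (h : ∀ p ∈ n.primeFactors, F p = G p) : F n = G n := by
  induction n using Nat.recOnMul with
  | zero => exact absurd rfl hn
  | one => rw [map_one, map_one]
  | prime p hp => exact h p (by simp [hp.primeFactors])
  | mul a b iha ihb =>
    rw [mul_ne_zero_iff] at hn
    rw [Nat.primeFactors_mul hn.1 hn.2] at h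
    rw [map_mul, map_mul, iha hn.1 fun p hp => h p (Finset.mem_union_left _ hp),
      ihb hn.2 fun p hp => h p (Finset.mem_union_right _ hp)]

section Decomposition

variable {q : ℕ} [NeZero q] {I : Type} [Fintype I] {D N : I → ℕ}

theorem localFactor_congr (hN : ∀ i, N i ∣ q) (hD : ∀ i, D i ∣ q)
    (ψ : ∀ i, DirichletCharacter ℂ (N i)) (c : I → ℂ) (χ : DirichletCharacter ℂ q)
    {F G : ℕ →*₀ ℂ} (h : ∀ p ∈ q.primeFactors, F p = G p) :
    localFactor hN D ψ c χ F = localFactor hN D ψ c χ G := by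
  have hd : ∀ i, F (D i) = G (D i) := fun i =>
    monoidWithZeroHom_eq_of_eq_on_primeFactors
      (fun h => NeZero.ne q (Nat.eq_zero_of_zero_dvd (h ▸ hD i)))
      fun p hp => h p (Nat.primeFactors_mono (hD i) (NeZero.ne q) hp)
  unfold localFactor
  refine Finset.sum_congr rfl fun i _ => ?_
  rw [hd, Finset.prod_congr rfl fun p hp => by rw [h p hp]]

/-- Truncating at a large height, the Euler product over the primes outside of `q` approximates
the `L`-functions of all characters and the prime sums over all residue classes. -/
theorem exists_truncation (q : ℕ) [NeZero q] {σ : ℝ} (hσ : 1 < σ) (h0 : (σ : ℂ) ≠ 0) {ε : ℝ}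
    (hε : 0 < ε) : ∃ Y : ℕ,
      (∀ χ : DirichletCharacter ℂ q, dist ((∑' n, characterTwist χ (riemannZetaSummandHom h0) n) *
        ∏ p ∈ Y.primesBelow \ q.primeFactors,
          (1 - characterTwist χ (riemannZetaSummandHom h0) p)) 1 < ε) ∧
      ∀ a : ZMod q, IsUnit a →
        ∑' n : ℕ, {p : ℕ | p.Prime ∧ (p : ZMod q) = a}.indicator (fun p : ℕ => (p : ℝ) ^ (-σ)) n - 1
          ≤ ∑ p ∈ Y.primesBelow \ q.primeFactors with ((p : ℕ) : ZMod q) = a, (p : ℝ) ^ (-σ) := by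
  have hre : 1 < (σ : ℂ).re := by simpa using hσ
  have h1 : ∀ χ : DirichletCharacter ℂ q, ∀ᶠ Y : ℕ in atTop,
      dist ((∑' n, characterTwist χ (riemannZetaSummandHom h0) n) *
        ∏ p ∈ Y.primesBelow \ q.primeFactors,
          (1 - characterTwist χ (riemannZetaSummandHom h0) p)) 1 < ε := fun χ => by
    refine (tendsto_tsum_mul_prod_one_sub (summable_norm_characterTwist χ
      (summable_riemannZetaSummand hre)) (tsum_characterTwist_ne_zero χ hre h0)
      fun p hp => ?_).eventually (ball_mem_nhds 1 hε)
    rw [characterTwist_apply, character_apply_of_prime_dvd _ (Nat.prime_of_mem_primeFactors hp)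
      (Nat.dvd_of_mem_primeFactors hp), zero_mul]
  have h2 : ∀ a : ZMod q, ∀ᶠ Y : ℕ in atTop, IsUnit a →
      ∑' n : ℕ, {p : ℕ | p.Prime ∧ (p : ZMod q) = a}.indicator (fun p : ℕ => (p : ℝ) ^ (-σ)) n - 1
        ≤ ∑ p ∈ Y.primesBelow \ q.primeFactors with ((p : ℕ) : ZMod q) = a, (p : ℝ) ^ (-σ) := by
    intro a
    by_cases ha : IsUnit a
    · have h3 := (summable_rpow_neg_of_one_lt hσ
        {p : ℕ | p.Prime ∧ (p : ZMod q) = a}).hasSum.tendsto_sum_nat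
      filter_upwards [h3.eventually_const_le (sub_one_lt _)] with Y hY _
      refine hY.trans_eq ?_
      rw [Finset.sum_indicator_eq_sum_filter]
      refine Finset.sum_congr ?_ fun _ _ => rfl
      ext p
      simp only [Finset.mem_filter, Finset.mem_range, Set.mem_ofPred_eq, Finset.mem_sdiff,
        Nat.mem_primesBelow]
      refine ⟨fun h => ⟨⟨⟨h.1, h.2.1⟩, fun hpq => ?_⟩, h.2.2⟩,
        fun h => ⟨h.1.1.1, h.1.1.2, h.2⟩⟩
      have hu := ha
      rw [← h.2.2, ZMod.isUnit_iff_coprime, h.2.1.coprime_iff_not_dvd] at hu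
      exact hu (Nat.dvd_of_mem_primeFactors hpq)
    · exact Eventually.of_forall fun _ h => absurd h ha
  obtain ⟨Y, hY⟩ := ((eventually_all.2 h1).and (eventually_all.2 h2)).exists
  exact ⟨Y, hY.1, hY.2⟩

theorem tsum_twist_eq_zero_of_sum_eq_zero (hN : ∀ i, N i ∣ q) (hD : ∀ i, D i ∣ q)
    (ψ : ∀ i, DirichletCharacter ℂ (N i)) (c : I → ℂ) {a : ZMod q → ℂ}
    (ha : ∀ n : ℕ, a n = ∑ i, if D i ∣ n then c i * ψ i (n / D i : ℕ) else 0)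
    {s : ℂ} (hs : 1 < s.re) (h0 : s ≠ 0) {t : ℝ} {P : Finset ℕ} (hP : ∀ p ∈ P, p.Prime)
    {ω₀ : ℕ → ℂ} (hω₀ : ∀ p, ‖ω₀ p‖ = 1) (hsum : ∑ χ : DirichletCharacter ℂ q,
      localFactor hN D ψ c χ (fun n => (n : ℂ) ^ (-(s + t * Complex.I))) *
        ((∑' n, characterTwist χ (riemannZetaSummandHom h0) n) *
          ∏ p ∈ P, (1 - characterTwist χ (riemannZetaSummandHom h0) p)) *
        ∏ p ∈ P, (1 - χ p * ω₀ p * (p : ℂ) ^ (-s))⁻¹ = 0) (hPq : Disjoint P q.primeFactors) :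
    ∃ ω : ℕ →*₀ ℂ, (∀ n, n ≠ 0 → ‖ω n‖ = 1) ∧ ∑' n : ℕ, a n * (ω n * (n : ℂ) ^ (-s)) = 0 := by
  classical
  have hu : ∀ p : ℕ, ‖(if p ∈ q.primeFactors then (p : ℂ) ^ (-(t * Complex.I)) else
      if p ∈ P then ω₀ p else 1)‖ = 1 := fun p => by
    split_ifs with h1 h2
    · rw [Complex.norm_natCast_cpow_of_pos (Nat.prime_of_mem_primeFactors h1).pos]
      simp
    · exact hω₀ p
    · exact norm_one
  obtain ⟨ω, hω, hωu⟩ := exists_monoidWithZeroHom_eq_on_primes hu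
  refine ⟨ω, hω, ?_⟩
  have hst : s + t * Complex.I ≠ 0 := Complex.ne_zero_of_one_lt_re (by simpa using hs)
  set g : ℕ →*₀ ℂ := ω * riemannZetaSummandHom h0 with hg_def
  have hg : ∀ n, g n = ω n * (n : ℂ) ^ (-s) := fun n => rfl
  have hnorm : ∀ n, ‖g n‖ = ‖riemannZetaSummandHom h0 n‖ := fun n => by
    rcases eq_or_ne n 0 with rfl | hn
    · simp
    · rw [hg, norm_mul, hω n hn, one_mul]
      rfl
  have hgs : Summable fun n => ‖g n‖ := by
    simp_rw [hnorm]
    exact summable_riemannZetaSummand hs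
  have hζs : Summable fun n => ‖riemannZetaSummandHom h0 n‖ := summable_riemannZetaSummand hs
  refine (tsum_periodic_mul_eq hN hD ψ c ha hgs).trans (Eq.trans ?_ hsum)
  refine Finset.sum_congr rfl fun χ _ => ?_
  have h1 : localFactor hN D ψ c χ g =
      localFactor hN D ψ c χ (fun n => (n : ℂ) ^ (-(s + t * Complex.I))) := by
    refine localFactor_congr hN hD ψ c χ (G := riemannZetaSummandHom hst) fun p hp => ?_
    have hpp := Nat.prime_of_mem_primeFactors hp
    rw [hg, hωu p hpp, if_pos hp, ← Complex.cpow_add _ _ (Nat.cast_ne_zero.2 hpp.ne_zero),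
      ← neg_add, add_comm]
    rfl
  have h2 : ∏ p ∈ P, (1 - characterTwist χ g p) =
      ∏ p ∈ P, (1 - χ p * ω₀ p * (p : ℂ) ^ (-s)) := by
    refine Finset.prod_congr rfl fun p hp => ?_
    rw [characterTwist_apply, hg, hωu p (hP p hp), if_neg (Finset.disjoint_left.1 hPq hp),
      if_pos hp, mul_assoc]
  have h3 := tsum_mul_prod_one_sub_eq (summable_norm_characterTwist χ hgs)
    (summable_norm_characterTwist χ hζs) hP fun p hp hpP => by
      rw [characterTwist_apply, characterTwist_apply]
      by_cases hpq : p ∈ q.primeFactors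
      · rw [character_apply_of_prime_dvd _ hp (Nat.dvd_of_mem_primeFactors hpq), zero_mul,
          zero_mul]
      · rw [hg, hωu p hp, if_neg hpq, if_neg hpP, one_mul]
        rfl
  have h4 : ∏ p ∈ P, (1 - χ p * ω₀ p * (p : ℂ) ^ (-s)) ≠ 0 := by
    rw [← h2]
    exact Finset.prod_ne_zero_iff.2 fun p hp => one_sub_ne_zero_of_norm_lt_one
      (norm_lt_one_of_summable (summable_norm_characterTwist χ hgs) (hP p hp))
  rw [← h1, ← h3, h2, Finset.prod_inv_distrib]
  field_simp

theorem exists_twist_tsum_eq_zero (hN : ∀ i, N i ∣ q) (hD : ∀ i, D i ∣ q)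
    (ψ : ∀ i, DirichletCharacter ℂ (N i)) (c : I → ℂ) {a : ZMod q → ℂ}
    (ha : ∀ n : ℕ, a n = ∑ i, if D i ∣ n then c i * ψ i (n / D i : ℕ) else 0)
    {χ₁ χ₂ : DirichletCharacter ℂ q} (hne : χ₁ ≠ χ₂) {t : ℝ}
    (h₁ : localFactor hN D ψ c χ₁ (fun n => (n : ℂ) ^ (-(1 + t * Complex.I))) ≠ 0)
    (h₂ : localFactor hN D ψ c χ₂ (fun n => (n : ℂ) ^ (-(1 + t * Complex.I))) ≠ 0) :
    ∃ (s : ℂ) (_ : 1 < s.re) (ω : ℕ →*₀ ℂ), (∀ n, n ≠ 0 → ‖ω n‖ = 1) ∧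
      ∑' n : ℕ, a n * (ω n * (n : ℂ) ^ (-s)) = 0 := by
  set σ : ℕ → ℝ := fun k => 1 + (1 / 2 : ℝ) ^ k with hσ_def
  have hσ : ∀ k, 1 < σ k := fun k => lt_add_of_pos_right _ (by positivity)
  have hre : ∀ k, 1 < ((σ k : ℝ) : ℂ).re := fun k => by simpa using hσ k
  have h0 : ∀ k, ((σ k : ℝ) : ℂ) ≠ 0 := fun k => Complex.ne_zero_of_one_lt_re (hre k)
  have hσlim : Tendsto σ atTop (𝓝 1) := by
    simpa [hσ_def] using (tendsto_pow_atTop_nhds_zero_of_lt_one (r := (1 / 2 : ℝ)) (by norm_num)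
      (by norm_num)).const_add 1
  choose Y hY1 hY2 using fun k : ℕ =>
    exists_truncation q (hσ k) (h0 k) (Nat.one_div_pos_of_nat (α := ℝ) (n := k))
  have hPp : ∀ k, ∀ p ∈ (Y k).primesBelow \ q.primeFactors, p.Prime := fun k p hp =>
    Nat.prime_of_mem_primesBelow (Finset.mem_sdiff.1 hp).1
  have hT : ∀ χ : DirichletCharacter ℂ q, Tendsto (fun k =>
      (∑' n, characterTwist χ (riemannZetaSummandHom (h0 k)) n) *
        ∏ p ∈ (Y k).primesBelow \ q.primeFactors,
          (1 - characterTwist χ (riemannZetaSummandHom (h0 k)) p)) atTop (𝓝 1) := fun χ =>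
    tendsto_iff_dist_tendsto_zero.2 (squeeze_zero (fun _ => dist_nonneg)
      (fun k => (hY1 k χ).le) tendsto_one_div_add_atTop_nhds_zero_nat)
  have hQ : ∀ χ : DirichletCharacter ℂ q, Tendsto (fun k =>
      localFactor hN D ψ c χ (fun n => (n : ℂ) ^ (-(((σ k : ℝ) : ℂ) + t * Complex.I)))) atTop
      (𝓝 (localFactor hN D ψ c χ (fun n => (n : ℂ) ^ (-(1 + t * Complex.I))))) := fun χ => by
    have hopen : IsOpen {s : ℂ | 0 < s.re} := isOpen_lt continuous_const Complex.continuous_re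
    have hcont := ((differentiableOn_localFactor hN hD ψ c χ).differentiableAt
      (hopen.mem_nhds (x := 1 + t * Complex.I) (by simp))).continuousAt
    refine hcont.tendsto.comp ?_
    have := (Complex.continuous_ofReal.tendsto (1 : ℝ)).comp hσlim
    simpa using this.add_const (t * Complex.I)
  have hev := eventually_exists_unimodular_zero (q := q)
    (P := fun k => (Y k).primesBelow \ q.primeFactors) (x := fun k p => (p : ℝ) ^ (-σ k)) hne
    (fun χ => (hQ χ).mul (hT χ)) (by simpa using h₁) (by simpa using h₂)
    (fun k p hp => ⟨(hPp k p hp).two_le, (ZMod.isUnit_iff_coprime _ _).2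
      (coprime_of_prime_of_notMem_primeFactors (hPp k p hp) (Finset.mem_sdiff.1 hp).2)⟩)
    (fun k p hp => ⟨by positivity, ?_⟩)
    (fun a ha => tendsto_atTop_mono (fun k => hY2 k a ha)
      (tendsto_atTop_add_const_right _ (-1) (tendsto_tsum_prime_rpow_atTop ha)))
  · obtain ⟨k, ω₀, hω₀, hsum⟩ := hev.exists
    have hcast : ∀ p : ℕ, (((p : ℝ) ^ (-σ k) : ℝ) : ℂ) = (p : ℂ) ^ (-((σ k : ℝ) : ℂ)) :=
      fun p => by
        rw [Complex.ofReal_cpow (Nat.cast_nonneg p)]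
        push_cast
        rfl
    simp_rw [hcast] at hsum
    exact ⟨_, hre k, tsum_twist_eq_zero_of_sum_eq_zero hN hD ψ c ha (hre k) (h0 k) (hPp k) hω₀
      hsum Finset.sdiff_disjoint⟩
  · rw [one_div, ← Real.rpow_neg_one]
    exact Real.rpow_le_rpow_of_exponent_le (by exact_mod_cast (hPp k p hp).one_lt.le)
      (neg_le_neg (hσ k).le)

end Decomposition

section Twist

variable {b : ℕ → ℂ} {B : ℝ}

theorem abscissaOfAbsConv_le_one_of_norm_le (hb : ∀ n, ‖b n‖ ≤ B) :
    LSeries.abscissaOfAbsConv b ≤ 1 :=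
  LSeries.abscissaOfAbsConv_le_of_le_const ⟨B, fun n _ => hb n⟩

theorem differentiableOn_LSeries_of_norm_le (hb : ∀ n, ‖b n‖ ≤ B) :
    DifferentiableOn ℂ (LSeries b) {s | 1 < s.re} :=
  (LSeries_differentiableOn b).mono fun s hs =>
    (abscissaOfAbsConv_le_one_of_norm_le hb).trans_lt (by exact_mod_cast hs)

theorem LSeriesSummable_of_norm_le (hb : ∀ n, ‖b n‖ ≤ B) {s : ℂ} (hs : 1 < s.re) :
    LSeriesSummable b s :=
  LSeriesSummable_of_abscissaOfAbsConv_lt_re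
    ((abscissaOfAbsConv_le_one_of_norm_le hb).trans_lt (by exact_mod_cast hs))

theorem frequently_LSeries_ne_zero (hb : ∀ n, ‖b n‖ ≤ B) (hb0 : ∃ n, n ≠ 0 ∧ b n ≠ 0) {s₀ : ℂ}
    (hs₀ : 1 < s₀.re) : ∃ᶠ s in 𝓝 s₀, LSeries b s ≠ 0 := by
  intro hev
  have hopen : IsOpen {s : ℂ | 1 < s.re} := isOpen_lt continuous_const Complex.continuous_re
  have hzero := ((differentiableOn_LSeries_of_norm_le hb).analyticOnNhd
    hopen).eqOn_zero_of_preconnected_of_eventuallyEq_zero (convex_halfSpace_re_gt 1).isPreconnected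
    hs₀ (hev.mono fun s hs => not_not.1 hs)
  obtain ⟨n, hn, hbn⟩ := hb0
  refine hbn ((LSeries_eventually_eq_zero_iff'.1 ?_).resolve_right ?_ n hn)
  · filter_upwards [eventually_gt_atTop 1] with x hx
    exact hzero (by simpa using hx)
  · exact ((abscissaOfAbsConv_le_one_of_norm_le hb).trans_lt (by decide)).ne

theorem norm_cpow_sub_le_two {ω : ℕ → ℂ} (hω : ∀ n, n ≠ 0 → ‖ω n‖ = 1) (t : ℝ) {n : ℕ}
    (hn : n ≠ 0) : ‖(n : ℂ) ^ (-(t * Complex.I)) - ω n‖ ≤ 2 := by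
  refine (norm_sub_le _ _).trans_eq ?_
  rw [hω n hn, Complex.norm_natCast_cpow_of_pos (Nat.pos_of_ne_zero hn)]
  norm_num

theorem rpow_mul_norm_cpow_sub_le (hB : 0 ≤ B) {ω : ℕ → ℂ} (hω : ∀ n, n ≠ 0 → ‖ω n‖ = 1) {σ : ℝ}
    (hσ : 1 < σ) (t : ℝ) (n : ℕ) :
    B * (n : ℝ) ^ (-σ) * ‖(n : ℂ) ^ (-(t * Complex.I)) - ω n‖ ≤ B * (n : ℝ) ^ (-σ) * 2 := by
  rcases eq_or_ne n 0 with rfl | hn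
  · simp [Real.zero_rpow (neg_ne_zero.2 (one_pos.trans hσ).ne')]
  · exact mul_le_mul_of_nonneg_left (norm_cpow_sub_le_two hω t hn) (by positivity)

theorem summable_const_mul_rpow_mul_two {σ : ℝ} (hσ : 1 < σ) :
    Summable fun n : ℕ => B * (n : ℝ) ^ (-σ) * 2 :=
  ((Real.summable_nat_rpow.2 (neg_lt_neg hσ)).mul_left B).mul_right 2

theorem norm_LSeries_add_sub_le (hb : ∀ n, ‖b n‖ ≤ B) {ω : ℕ → ℂ}
    (hω : ∀ n, n ≠ 0 → ‖ω n‖ = 1) {σ t : ℝ} (hσ : 1 < σ) {s : ℂ} (hs : σ ≤ s.re) :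
    ‖LSeries b (s + t * Complex.I) - LSeries (fun n => b n * ω n) s‖ ≤
      ∑' n : ℕ, B * (n : ℝ) ^ (-σ) * ‖(n : ℂ) ^ (-(t * Complex.I)) - ω n‖ := by
  have hB : 0 ≤ B := (norm_nonneg _).trans (hb 0)
  have hsum : Summable fun n : ℕ => B * (n : ℝ) ^ (-σ) * ‖(n : ℂ) ^ (-(t * Complex.I)) - ω n‖ :=
    (summable_const_mul_rpow_mul_two hσ).of_nonneg_of_le (fun n => by positivity)
      (rpow_mul_norm_cpow_sub_le hB hω hσ t)
  have h1 : LSeriesSummable b (s + t * Complex.I) :=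
    LSeriesSummable_of_norm_le hb (by simpa using hσ.trans_le hs)
  have h2 : LSeriesSummable (fun n => b n * ω n) s := by
    refine LSeriesSummable_of_abscissaOfAbsConv_lt_re (lt_of_le_of_lt
      (LSeries.abscissaOfAbsConv_le_of_le_const ⟨B, fun n hn => ?_⟩)
      (by exact_mod_cast hσ.trans_le hs))
    rw [norm_mul, hω n hn, mul_one]
    exact hb n
  rw [LSeries, LSeries, ← h1.tsum_sub h2]
  refine tsum_of_norm_bounded hsum.hasSum fun n => ?_
  rcases eq_or_ne n 0 with rfl | hn
  · simp only [LSeries.term_zero, sub_zero, norm_zero]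
    positivity
  have hn0 : (n : ℂ) ≠ 0 := Nat.cast_ne_zero.2 hn
  have hn1 : (1 : ℝ) ≤ n := by exact_mod_cast Nat.one_le_iff_ne_zero.2 hn
  have hsplit : LSeries.term b (s + t * Complex.I) n - LSeries.term (fun n => b n * ω n) s n =
      b n * (n : ℂ) ^ (-s) * ((n : ℂ) ^ (-(t * Complex.I)) - ω n) := by
    rw [LSeries.term_of_ne_zero hn, LSeries.term_of_ne_zero hn, div_eq_mul_inv, div_eq_mul_inv,
      ← Complex.cpow_neg, ← Complex.cpow_neg, neg_add, Complex.cpow_add _ _ hn0]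
    ring
  rw [hsplit, norm_mul, norm_mul, Complex.norm_natCast_cpow_of_pos (Nat.pos_of_ne_zero hn)]
  gcongr
  · exact hb n
  · exact neg_le_neg hs

theorem tendsto_tsum_norm_cpow_sub (hB : 0 ≤ B) {ω : ℕ → ℂ} (hω : ∀ n, n ≠ 0 → ‖ω n‖ = 1) {σ : ℝ}
    (hσ : 1 < σ) {τ : ℕ → ℝ} (hτ : ∀ n : ℕ, n ≠ 0 →
      Tendsto (fun j => (n : ℂ) ^ (-(τ j * Complex.I))) atTop (𝓝 (ω n))) :
    Tendsto (fun j => ∑' n : ℕ, B * (n : ℝ) ^ (-σ) * ‖(n : ℂ) ^ (-(τ j * Complex.I)) - ω n‖) atTop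
      (𝓝 0) := by
  rw [← tsum_zero (α := ℝ) (β := ℕ)]
  refine tendsto_tsum_of_dominated_convergence (summable_const_mul_rpow_mul_two (B := B) hσ)
    (fun n => ?_) (Eventually.of_forall fun j n => ?_)
  · rcases eq_or_ne n 0 with rfl | hn
    · simp [Real.zero_rpow (neg_ne_zero.2 (one_pos.trans hσ).ne')]
    · simpa using ((hτ n hn).sub_const (ω n)).norm.const_mul (B * (n : ℝ) ^ (-σ))
  · rw [Real.norm_of_nonneg (by positivity)]
    exact rpow_mul_norm_cpow_sub_le hB hω hσ (τ j) n

theorem infinite_LSeries_zeros_of_twist (hb : ∀ n, ‖b n‖ ≤ B) (hb0 : ∃ n, n ≠ 0 ∧ b n ≠ 0)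
    {ω : ℕ →*₀ ℂ} (hω : ∀ n, n ≠ 0 → ‖ω n‖ = 1) {s₀ : ℂ} (hs₀ : 1 < s₀.re)
    (hzero : LSeries (fun n => b n * ω n) s₀ = 0) :
    {s : ℂ | 1 < s.re ∧ LSeries b s = 0}.Infinite := by
  have hopen : IsOpen {s : ℂ | 1 < s.re} := isOpen_lt continuous_const Complex.continuous_re
  have hωle : ∀ n, ‖ω n‖ ≤ 1 := fun n => by
    rcases eq_or_ne n 0 with rfl | hn
    · simp
    · exact (hω n hn).le
  have hbω : ∀ n, ‖b n * ω n‖ ≤ B := fun n => by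
    rw [norm_mul]
    exact (mul_le_of_le_one_right (norm_nonneg _) (hωle n)).trans (hb n)
  have hbω0 : ∃ n, n ≠ 0 ∧ b n * ω n ≠ 0 := by
    obtain ⟨n, hn, hbn⟩ := hb0
    exact ⟨n, hn, mul_ne_zero hbn (norm_ne_zero_iff.1 (by rw [hω n hn]; exact one_ne_zero))⟩
  obtain ⟨r, hr, -, hball, ε, hε, hclose⟩ := exists_zero_of_close hopen hs₀
    (differentiableOn_LSeries_of_norm_le hbω) hzero (frequently_LSeries_ne_zero hbω hbω0 hs₀)
    one_pos
  obtain ⟨τ, hτ, hτω⟩ := exists_tendsto_cpow_of_unimodular ω hω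
  have hσ : 1 < s₀.re - r := by
    have : s₀ - r ∈ {s : ℂ | 1 < s.re} := hball (by simp [abs_of_pos hr])
    simpa using this
  intro hfin
  obtain ⟨M, hM⟩ := (hfin.image Complex.im).bddAbove
  obtain ⟨j, hj1, hj2⟩ := (((tendsto_tsum_norm_cpow_sub ((norm_nonneg _).trans (hb 0)) hω hσ
    hτω).eventually_lt_const hε).and (hτ.eventually_gt_atTop (M - s₀.im + r))).exists
  have hmaps : Set.MapsTo (fun s : ℂ => s + τ j * Complex.I) {s | 1 < s.re} {s | 1 < s.re} :=
    fun s hs => by simpa using hs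
  obtain ⟨w, hw, hw0⟩ := hclose (fun s => LSeries b (s + τ j * Complex.I))
    ((differentiableOn_LSeries_of_norm_le hb).comp
      (differentiable_id.add_const _).differentiableOn hmaps) fun z hz => by
      have hdist := (Complex.abs_re_le_norm (z - s₀)).trans (mem_closedBall_iff_norm.1 hz)
      rw [Complex.sub_re] at hdist
      exact (norm_LSeries_add_sub_le hb hω hσ (by linarith [neg_le_of_abs_le hdist])).trans_lt hj1
  have him := hM ⟨_, ⟨hmaps (hball hw), hw0⟩, rfl⟩
  have hdist := (Complex.abs_im_le_norm (w - s₀)).trans (mem_closedBall_iff_norm.1 hw)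
  rw [Complex.sub_im] at hdist
  simp only [Complex.add_im, Complex.mul_im, Complex.ofReal_re, Complex.I_im, Complex.ofReal_im,
    Complex.I_re, mul_one, mul_zero, add_zero] at him
  linarith [neg_le_of_abs_le hdist]

end Twist

theorem tsum_div_natCast_succ_cpow {u v : ℕ → ℂ} (huv : ∀ n, u n = v (n + 1)) {B : ℝ}
    (hv : ∀ n, ‖v n‖ ≤ B) {s : ℂ} (hs : 1 < s.re) :
    ∑' n : ℕ, u n / ((n : ℂ) + 1) ^ s = LSeries v s := by
  rw [LSeries, (LSeriesSummable_of_norm_le hv hs).tsum_eq_zero_add, LSeries.term_zero, zero_add]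
  refine tsum_congr fun n => ?_
  rw [LSeries.term_of_ne_zero n.succ_ne_zero, huv]
  push_cast
  rfl

theorem LSeries_eq_tsum_mul_cpow_neg {v : ℕ → ℂ} {s : ℂ} (hs : s ≠ 0) :
    LSeries v s = ∑' n : ℕ, v n * (n : ℂ) ^ (-s) :=
  tsum_congr fun n => by
    rcases eq_or_ne n 0 with rfl | hn
    · rw [LSeries.term_zero, Nat.cast_zero, Complex.zero_cpow (neg_ne_zero.2 hs), mul_zero]
    · rw [LSeries.term_of_ne_zero hn, Complex.cpow_neg, div_eq_mul_inv]

theorem exists_zmod_function_eq {f : ℕ → ℂ} {q : ℕ} [NeZero q] (hper : ∀ n, f (n + q) = f n) :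
    ∃ a : ZMod q → ℂ, ∀ n : ℕ, f n = a (n + 1 : ℕ) := by
  have hf : Function.Periodic f q := hper
  refine ⟨fun z => f (z - 1).val, fun n => ?_⟩
  change f n = f (((n + 1 : ℕ) : ZMod q) - 1).val
  rw [Nat.cast_succ, add_sub_cancel_right, ZMod.val_natCast, hf.map_mod_nat]

/-- For `f` periodic of period `q ≥ 1`, not identically zero, if the
Dirichlet series `F(s, f, 1) = ∑ f(n)/(n+1)^s` is not the product of a Dirichlet
polynomial and a Dirichlet `L`-function on `Re s > 1`, then it has infinitely
many zeros with `Re s > 1`. -/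
theorem periodic_dirichlet_series_infinitely_many_zeros
    (f : ℕ → ℂ) (hf : f ≠ 0) (q : ℕ) (hq : 1 ≤ q) (hper : ∀ n, f (n + q) = f n)
    (h : ¬ ∃ (𝒩 : Finset ℕ) (_ : 𝒩.Nonempty) (_ : ∀ n ∈ 𝒩, 0 < n) (a : ℕ → ℂ)
        (k : ℕ) (χ : DirichletCharacter ℂ k),
      ∀ s : ℂ, 1 < s.re →
        ∑' n : ℕ, f n / ((n : ℂ) + 1) ^ s =
          (∑ n ∈ 𝒩, a n * (n : ℂ) ^ (-s)) *
            ∑' m : ℕ, χ ((m + 1 : ℕ)) / ((m : ℂ) + 1) ^ s) :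
    {s : ℂ | 1 < s.re ∧ ∑' n : ℕ, f n / ((n : ℂ) + 1) ^ s = 0}.Infinite := by
  have : NeZero q := ⟨Nat.one_le_iff_ne_zero.1 hq⟩
  obtain ⟨a, ha⟩ := exists_zmod_function_eq hper
  obtain ⟨B, hB⟩ := (Set.finite_range fun z => ‖a z‖).bddAbove
  have hb : ∀ n : ℕ, ‖a n‖ ≤ B := fun n => hB ⟨_, rfl⟩
  have hF : ∀ s : ℂ, 1 < s.re →
      ∑' n : ℕ, f n / ((n : ℂ) + 1) ^ s = LSeries (fun n => a n) s := fun s hs =>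
    tsum_div_natCast_succ_cpow ha hb hs
  have hb0 : ∃ n : ℕ, n ≠ 0 ∧ a n ≠ 0 := by
    obtain ⟨n, hn⟩ := Function.ne_iff.1 hf
    exact ⟨n + 1, n.succ_ne_zero, by rw [← ha]; exact hn⟩
  obtain ⟨I, _, D, N, ψ, c, hDN, hexp⟩ := exists_character_expansion a
  have hD := fun i => (hDN i).1
  have hN := fun i => (hDN i).2
  obtain ⟨χ₁, χ₂, hne, ⟨⟨s₁, hs₁⟩, h₁⟩, ⟨⟨s₂, hs₂⟩, h₂⟩⟩ := exists_ne_of_not_forall_eq_zero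
    (Q := fun (χ : DirichletCharacter ℂ q) (s : {s : ℂ // 1 < s.re}) =>
      localFactor hN D ψ c χ fun n => (n : ℂ) ^ (-(s : ℂ))) fun χ₀ h0 => by
    obtain ⟨P, hP, hPF⟩ := exists_dirichletPolynomial_of_localFactor_eq_zero hN hD ψ c hexp χ₀
      fun χ hχ s hs => h0 χ hχ ⟨s, hs⟩
    obtain ⟨𝒩, hne, hpos, e, he⟩ := exists_coeff_of_mem_dirichletPolynomials hP
    refine h ⟨𝒩, hne, hpos, e, _, χ₀.primitiveCharacter, fun s hs => ?_⟩
    have hs0 := Complex.ne_zero_of_one_lt_re hs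
    rw [hF s hs, LSeries_eq_tsum_mul_cpow_neg hs0, hPF s hs, he s,
      tsum_div_natCast_succ_cpow (v := fun n => χ₀.primitiveCharacter n) (fun _ => rfl)
        (fun n => χ₀.primitiveCharacter.norm_le_one n) hs, LSeries_eq_tsum_mul_cpow_neg hs0]
  obtain ⟨t, ht₁, ht₂⟩ := exists_ne_zero_on_vertical_line
    (differentiableOn_localFactor hN hD ψ c χ₁) (differentiableOn_localFactor hN hD ψ c χ₂)
    ⟨s₁, one_pos.trans hs₁, h₁⟩ ⟨s₂, one_pos.trans hs₂, h₂⟩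
  obtain ⟨s₀, hs₀, ω, hω, hzero⟩ := exists_twist_tsum_eq_zero hN hD ψ c hexp hne ht₁ ht₂
  have hinf := infinite_LSeries_zeros_of_twist hb hb0 hω hs₀ (by
    rw [LSeries_eq_tsum_mul_cpow_neg (Complex.ne_zero_of_one_lt_re hs₀)]
    simpa only [mul_assoc] using hzero)
  exact hinf.mono fun s hs => ⟨hs.1, (hF s hs.1).trans hs.2⟩
end

section
/- Let 𝒩 be a finite nonempty set of positive integers, let a : 𝒩 → ℂ with a(n₁) ≠ 0 where n₁ = min 𝒩, and let χ be a Dirichlet character modulo k. Define b : ℤ → ℂ by b(m) = ∑_{n ∈ 𝒩, n ∣ m} a(n) χ(m/n). Suppose there exist coprime integers h and r with r ≥ 1 such that b(m) ≠ 0 implies m ≡ h (mod r). Then r divides 2 (i.e., r ≤ 2). -/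
/-- If the Dirichlet series coefficients `b(m) = ∑_{n ∈ 𝒩, n ∣ m} a(n) χ(m/n)`
of `P(s)L(s,χ)` (with `a(min 𝒩) ≠ 0`) are supported on a single residue class
`h (mod r)` with `gcd(h, r) = 1` and `r ≥ 1`, then `r` divides `2`. -/
theorem coeffs_supported_single_class_imp_r_dvd_two
    (𝒩 : Finset ℕ) (h𝒩 : 𝒩.Nonempty) (hpos : ∀ n ∈ 𝒩, 0 < n)
    (a : ℕ → ℂ) (ha : a (𝒩.min' h𝒩) ≠ 0)
    (k : ℕ) (χ : DirichletCharacter ℂ k)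
    (B : ℤ → ℂ)
    (hB : ∀ m : ℤ, B m = ∑ n ∈ 𝒩.filter (fun n : ℕ => (n : ℤ) ∣ m),
      a n * χ (((m / (n : ℤ)) : ℤ) : ZMod k))
    (h r : ℤ) (hr : 1 ≤ r) (hcop : IsCoprime h r)
    (hsupp : ∀ m : ℤ, B m ≠ 0 → m ≡ h [ZMOD r]) :
    r ∣ 2 := by
  set n₁ := 𝒩.min' h𝒩 with hn₁
  have hmem : n₁ ∈ 𝒩 := 𝒩.min'_mem h𝒩
  have hn₁pos : 0 < n₁ := hpos n₁ hmem
  have key : ∀ u : ℤ, IsUnit u → (n₁ : ℤ) * u ≡ h [ZMOD r] := by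
    intro u hu
    apply hsupp
    have hfilter : 𝒩.filter (fun n : ℕ => (n : ℤ) ∣ (n₁ : ℤ) * u) = {n₁} := by
      ext n
      simp only [Finset.mem_filter, Finset.mem_singleton, hu.dvd_mul_right, Int.natCast_dvd_natCast]
      constructor
      · rintro ⟨hn, hdvd⟩
        exact le_antisymm (Nat.le_of_dvd hn₁pos hdvd) (𝒩.min'_le n hn)
      · rintro rfl
        exact ⟨hmem, dvd_rfl⟩
    rw [hB, hfilter, Finset.sum_singleton,
      Int.mul_ediv_cancel_left _ (Int.natCast_ne_zero.mpr hn₁pos.ne')]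
    exact mul_ne_zero ha ((hu.map (Int.castRingHom (ZMod k))).map χ).ne_zero
  have hplus := (key 1 isUnit_one).dvd
  have hminus := (key (-1) isUnit_one.neg).dvd
  refine hcop.symm.dvd_of_dvd_mul_left ?_
  convert dvd_add hplus hminus using 1
  ring
end
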